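/- arXiv:math/0603614 — 2 statements merged into one kernel-verified Lean document; each statement's English description precedes it below -/
import Mathlib

section
/- There exists an absolute constant c > 0 such that for every n-dimensional real normed space X (n ≥ 2), the equilateral number satisfies e(X) ≥ c·(log n)^{1/3}. -/
/-- A set `S` in a normed space is *equilateral* if there is a common distance `d > 0`
between any two distinct points of `S`. -/
def IsEquilateral {X : Type*} [NormedAddCommGroup X] (S : Set X) : Prop :=
  ∃ d : ℝ, 0 < d ∧ ∀ x ∈ S, ∀ y ∈ S, x ≠ y → ‖x - y‖ = d

/-- A seminorm on `Fin k → ℝ` is bounded on a box by its values at the vertices. -/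
lemma Seminorm.le_of_mem_convexHull_pi {k : ℕ} (N : Seminorm ℝ (Fin k → ℝ)) {t : Fin k → Set ℝ}
    {M : ℝ} {x : Fin k → ℝ} (hx : ∀ l, x l ∈ convexHull ℝ (t l))
    (hM : ∀ w : Fin k → ℝ, (∀ l, w l ∈ t l) → N w ≤ M) : N x ≤ M := by
  have hx' : x ∈ convexHull ℝ (Set.univ.pi t) := by
    rw [convexHull_pi]
    exact fun l _ => hx l
  obtain ⟨w, hw, hle⟩ := N.convexOn.exists_ge_of_mem_convexHull (Set.subset_univ _) hx'
  exact hle.trans (hM w fun l => hw l (Set.mem_univ l))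

lemma mem_convexHull_pair_of_abs_le {r x : ℝ} (h : |x| ≤ r) : x ∈ convexHull ℝ {r, -r} := by
  have hr : -r ≤ r := by linarith [abs_nonneg x]
  rw [convexHull_pair, segment_symm, segment_eq_Icc hr]
  exact abs_le.1 h

/-- `N` is close to the Euclidean norm, up to a factor `1 ± δ`, on all vectors whose coordinates
lie in `{0, 1, -1, ρ, -ρ}`. -/
def Seminorm.AlmostEuclideanOnGrid {k : ℕ} (N : Seminorm ℝ (Fin k → ℝ)) (ρ δ : ℝ) : Prop :=
  ∀ a : Fin k → ℝ, (∀ l, a l ∈ ({0, 1, -1, ρ, -ρ} : Set ℝ)) →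
    |N a - √(∑ l, a l ^ 2)| ≤ δ * √(∑ l, a l ^ 2)

namespace Seminorm.AlmostEuclideanOnGrid

variable {k : ℕ} {N : Seminorm ℝ (Fin k → ℝ)} {ρ δ : ℝ}

lemma apply_single_le (h : N.AlmostEuclideanOnGrid ρ δ) (i : Fin k) :
    N (Pi.single i 1) ≤ 1 + δ := by
  have := h (Pi.single i 1) (fun l => by
    by_cases hl : l = i
    · subst hl; simp
    · simp [hl])
  have hs : ∑ l, (Pi.single i 1 : Fin k → ℝ) l ^ 2 = 1 := by
    rw [Finset.sum_eq_single i] <;> simp +contextual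
  rw [hs, Real.sqrt_one] at this
  linarith [(abs_le.1 this).2]

lemma sum_sq_le {k : ℕ} {i j : Fin k} (hij : i ≠ j) {w : Fin k → ℝ} {ρ : ℝ} (hi : w i = 1)
    (hj : w j = -1) (hw : ∀ l, l ≠ i → l ≠ j → w l ^ 2 ≤ ρ ^ 2) :
    ∑ l, w l ^ 2 ≤ 2 + k * ρ ^ 2 := by
  have hle : ∀ l, w l ^ 2 ≤ (if l = i then 1 else 0) + (if l = j then 1 else 0) + ρ ^ 2 := by
    intro l
    by_cases h1 : l = i
    · subst h1
      simp only [hi, if_true, if_neg hij]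
      nlinarith [sq_nonneg ρ]
    · by_cases h2 : l = j
      · subst h2
        simp only [hj, if_true, if_neg h1]
        nlinarith [sq_nonneg ρ]
      · simpa [h1, h2] using hw l h1 h2
  calc ∑ l, w l ^ 2 ≤ ∑ l, ((if l = i then 1 else 0) + (if l = j then 1 else 0) + ρ ^ 2) :=
        Finset.sum_le_sum fun l _ => hle l
    _ = 2 + k * ρ ^ 2 := by
        simp [Finset.sum_add_distrib]; norm_num

lemma abs_apply_single_sub_single (h : N.AlmostEuclideanOnGrid ρ δ) {i j : Fin k} (hij : i ≠ j) :
    |N (Pi.single i 1 - Pi.single j 1) - √2| ≤ δ * √2 := by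
  have := h (Pi.single i 1 - Pi.single j 1) (fun l => by
    by_cases hl : l = i
    · subst hl; simp [hij]
    · by_cases hl' : l = j
      · subst hl'; simp [hl]
      · simp [hl, hl'])
  have hs : ∑ l, (Pi.single i 1 - Pi.single j 1 : Fin k → ℝ) l ^ 2 = 2 := by
    have : ∀ l, (Pi.single i 1 - Pi.single j 1 : Fin k → ℝ) l ^ 2 =
        (if l = i then 1 else 0) + (if l = j then 1 else 0) := by
      intro l
      by_cases hl : l = i
      · subst hl; simp [hij]
      · by_cases hl' : l = j
        · subst hl'; simp [hl]
        · simp [hl, hl']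
    simp only [this, Finset.sum_add_distrib]
    simp; norm_num
  rwa [hs] at this

lemma apply_single_sub_single_add_le (h : N.AlmostEuclideanOnGrid ρ δ) (hδ : 0 ≤ δ)
    {i j : Fin k} (hij : i ≠ j) {v : Fin k → ℝ} (hi : v i = 0) (hj : v j = 0)
    (hv : ∀ l, |v l| ≤ ρ) :
    N (Pi.single i 1 - Pi.single j 1 + v) ≤ (1 + δ) * (√2 * (1 + k * ρ ^ 2 / 4)) := by
  apply N.le_of_mem_convexHull_pi
    (t := fun l => if l = i then {1} else if l = j then {-1} else {ρ, -ρ})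
  · intro l
    by_cases hl : l = i
    · subst hl; simp [hij, hi]
    · by_cases hl' : l = j
      · subst hl'; simp [hl, hj]
      · simpa only [Pi.add_apply, Pi.sub_apply, Pi.single_eq_of_ne hl, Pi.single_eq_of_ne hl',
          sub_zero, zero_add, if_neg hl, if_neg hl'] using mem_convexHull_pair_of_abs_le (hv l)
  · intro w hw
    have hwi : w i = 1 := by simpa using hw i
    have hwj : w j = -1 := by simpa [hij.symm] using hw j
    have hwl : ∀ l, l ≠ i → l ≠ j → w l = ρ ∨ w l = -ρ := fun l h1 h2 => by
      simpa [h1, h2] using hw l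
    have key := h w (fun l => by
      by_cases hl : l = i
      · subst hl; simp [hwi]
      · by_cases hl' : l = j
        · subst hl'; simp [hwj]
        · rcases hwl l hl hl' with e | e <;> simp [e])
    have hsum : ∑ l, w l ^ 2 ≤ 2 + k * ρ ^ 2 := sum_sq_le hij hwi hwj fun l h1 h2 => by
      rcases hwl l h1 h2 with e | e <;> simp [e]
    have hsqrt : √(∑ l, w l ^ 2) ≤ √2 * (1 + k * ρ ^ 2 / 4) := by
      have hk : 0 ≤ (k : ℝ) * ρ ^ 2 := by positivity
      apply Real.sqrt_le_iff.2 ⟨by positivity, ?_⟩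
      rw [mul_pow, Real.sq_sqrt (by norm_num)]
      nlinarith
    have := (abs_le.1 key).2
    nlinarith

lemma apply_le_of_abs_le (h : N.AlmostEuclideanOnGrid ρ δ) (hδ : 0 ≤ δ) (hρ : 0 ≤ ρ)
    {v : Fin k → ℝ} (hv : ∀ l, |v l| ≤ ρ) : N v ≤ (1 + δ) * (k * ρ) := by
  apply N.le_of_mem_convexHull_pi (t := fun _ => {ρ, -ρ})
    (fun l => mem_convexHull_pair_of_abs_le (hv l))
  intro w hw
  have hwl : ∀ l, w l = ρ ∨ w l = -ρ := fun l => by simpa using hw l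
  have key := h w (fun l => by rcases hwl l with e | e <;> simp [e])
  have hsum : ∑ l, w l ^ 2 = k * ρ ^ 2 := by
    rw [Finset.sum_congr rfl (g := fun _ => ρ ^ 2)]
    · simp
    · intro l _
      rcases hwl l with e | e <;> simp [e]
  have hsqrt : √(∑ l, w l ^ 2) ≤ k * ρ := by
    apply Real.sqrt_le_iff.2 ⟨by positivity, ?_⟩
    rw [hsum, mul_pow]
    gcongr
    exact_mod_cast Nat.le_self_pow two_ne_zero k
  have := (abs_le.1 key).2
  nlinarith

variable {β : ℝ}

lemma apply_le_add (N : Seminorm ℝ (Fin k → ℝ)) (i j : Fin k) (a b : ℝ) (v : Fin k → ℝ) :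
    N (Pi.single i 1 - (1 + a) • Pi.single j 1 + v) ≤
      N (Pi.single i 1 - (1 + b) • Pi.single j 1 + v) + |a - b| * N (Pi.single j 1) := by
  have e : (Pi.single i 1 - (1 + a) • Pi.single j 1 + v : Fin k → ℝ) =
      (Pi.single i 1 - (1 + b) • Pi.single j 1 + v) + (b - a) • Pi.single j 1 := by
    module
  rw [e]
  refine (map_add_le_add N _ _).trans ?_
  rw [map_smul_eq_mul, Real.norm_eq_abs, abs_sub_comm]

/-- Off the two main coordinates, the seminorm has a small Lipschitz constant. -/
lemma apply_sub_apply_le (hβ : 0 < β) (hβ' : β ≤ 1 / 10000) (hk : k * (200 * β) = 1 / 50)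
    (h : N.AlmostEuclideanOnGrid (200 * β) (β / 25)) {i j : Fin k} (hij : i ≠ j) {a : ℝ}
    (ha : |a| ≤ β) {v v' : Fin k → ℝ} (hi : v i = 0) (hj : v j = 0) (hi' : v' i = 0)
    (hj' : v' j = 0) (hv' : ∀ l, |v' l| ≤ 2 * β) {η : ℝ}
    (hη : ∀ l, |v l - v' l| ≤ η) (hη' : η ≤ 4 * β) :
    N (Pi.single i 1 - (1 + a) • Pi.single j 1 + v) -
      N (Pi.single i 1 - (1 + a) • Pi.single j 1 + v') ≤ η / 20 := by
  have hη0 : 0 ≤ η := (abs_nonneg _).trans (hη i)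
  rcases hη0.eq_or_lt with h0 | hpos
  · have : v = v' := funext fun l => by
      have := hη l
      rw [← h0] at this
      exact sub_eq_zero.1 (abs_nonpos_iff.1 this)
    simpa [this] using div_nonneg hη0 (by norm_num)
  set s : ℝ := η / (198 * β) with hs
  have hs0 : 0 < s := by positivity
  have hs1 : s ≤ 1 := by
    rw [hs, div_le_one (by positivity)]; linarith
  set w : Fin k → ℝ := v' + s⁻¹ • (v - v') with hw
  have hsη : s⁻¹ * η = 198 * β := by
    rw [hs]; field_simp
  have hwρ : ∀ l, |w l| ≤ 200 * β := by
    intro l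
    calc |w l| ≤ |v' l| + |s⁻¹ * (v l - v' l)| := by
          simpa [hw] using abs_add_le (v' l) (s⁻¹ * (v l - v' l))
      _ = |v' l| + s⁻¹ * |v l - v' l| := by rw [abs_mul, abs_of_pos (inv_pos.2 hs0)]
      _ ≤ 2 * β + s⁻¹ * η := by gcongr; exacts [hv' l, hη l]
      _ = 200 * β := by rw [hsη]; ring
  have hδ0 : 0 ≤ β / 25 := by positivity
  have hmax : (1 + β / 25) * (√2 * (1 + k * (200 * β) ^ 2 / 4)) ≤ √2 * (1 + 1.05 * β) := by
    have : (k : ℝ) * (200 * β) ^ 2 = 4 * β := by rw [pow_two, ← mul_assoc, hk]; ring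
    rw [this]
    have h2 : 0 ≤ √2 := by positivity
    have : (1 + β / 25) * (1 + 4 * β / 4) ≤ 1 + 1.05 * β := by nlinarith
    nlinarith
  have hw1 := (h.apply_single_sub_single_add_le hδ0 hij (v := w) (by simp [hw, hi, hi'])
    (by simp [hw, hj, hj']) hwρ).trans hmax
  have hw2 := (h.apply_single_sub_single_add_le hδ0 hij (v := -v') (by simp [hi'])
    (by simp [hj']) (fun l => by simpa using (hv' l).trans (by linarith))).trans hmax
  have hj1 := h.apply_single_le j
  have hlow := (abs_le.1 (h.abs_apply_single_sub_single hij)).1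
  have hNj : |a| * N (Pi.single j 1) ≤ 1.01 * β := by
    have := apply_nonneg N (Pi.single j 1)
    have := abs_nonneg a
    nlinarith
  have hup := apply_le_add N i j a 0 w
  have hdn := apply_le_add N i j 0 a v'
  simp only [add_zero, one_smul, sub_zero, zero_sub, abs_neg] at hup hdn
  have hsymm : 2 * N (Pi.single i 1 - Pi.single j 1) ≤
      N (Pi.single i 1 - Pi.single j 1 + v') + N (Pi.single i 1 - Pi.single j 1 + -v') := by
    have e : (2 : ℝ) • (Pi.single i 1 - Pi.single j 1 : Fin k → ℝ) =
        (Pi.single i 1 - Pi.single j 1 + v') + (Pi.single i 1 - Pi.single j 1 + -v') := by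
      module
    have h3 := map_add_le_add N (Pi.single i 1 - Pi.single j 1 + v')
      (Pi.single i 1 - Pi.single j 1 + -v')
    rw [← e, map_smul_eq_mul] at h3
    simpa using h3
  have hconv : N (Pi.single i 1 - (1 + a) • Pi.single j 1 + v) ≤
      (1 - s) * N (Pi.single i 1 - (1 + a) • Pi.single j 1 + v') +
        s * N (Pi.single i 1 - (1 + a) • Pi.single j 1 + w) := by
    have hvw : v = (1 - s) • v' + s • w := by
      rw [hw, smul_add, smul_smul, mul_inv_cancel₀ hs0.ne']
      module
    have e : (Pi.single i 1 - (1 + a) • Pi.single j 1 + v : Fin k → ℝ) =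
        (1 - s) • (Pi.single i 1 - (1 + a) • Pi.single j 1 + v') +
        s • (Pi.single i 1 - (1 + a) • Pi.single j 1 + w) := by
      conv_lhs => rw [hvw]
      module
    rw [e]
    refine (map_add_le_add N _ _).trans ?_
    rw [map_smul_eq_mul, map_smul_eq_mul, Real.norm_of_nonneg hs0.le,
      Real.norm_of_nonneg (sub_nonneg.2 hs1)]
  have hsqrt : √2 ≤ 1.42 := by
    rw [Real.sqrt_le_left (by norm_num)]; norm_num
  have hdiff : N (Pi.single i 1 - (1 + a) • Pi.single j 1 + w) -
      N (Pi.single i 1 - (1 + a) • Pi.single j 1 + v') ≤ 9.9 * β := by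
    nlinarith
  have hsβ : s * (9.9 * β) = η / 20 := by
    rw [hs]; field_simp; norm_num
  nlinarith

/-- Along the main coordinate, the seminorm grows with a slope between `1 / 4` and `2`. -/
lemma slope_bounds (hβ : 0 < β) (hβ' : β ≤ 1 / 10000) (hk : k * (200 * β) = 1 / 50)
    (h : N.AlmostEuclideanOnGrid (200 * β) (β / 25)) {i j : Fin k} (hij : i ≠ j) {a a' : ℝ}
    (ha : |a| ≤ β) (haa' : a' ≤ a) (ha' : |a'| ≤ β) {v : Fin k → ℝ} (hv : ∀ l, |v l| ≤ 2 * β) :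
    (a - a') / 4 ≤ N (Pi.single i 1 - (1 + a) • Pi.single j 1 + v) -
        N (Pi.single i 1 - (1 + a') • Pi.single j 1 + v) ∧
      N (Pi.single i 1 - (1 + a) • Pi.single j 1 + v) -
        N (Pi.single i 1 - (1 + a') • Pi.single j 1 + v) ≤ 2 * (a - a') := by
  have hδ0 : 0 ≤ β / 25 := by positivity
  have hj1 := h.apply_single_le j
  have hj0 := apply_nonneg N (Pi.single j 1)
  constructor
  · have hab := abs_le.1 ha
    have hab' := abs_le.1 ha'
    set s : ℝ := (a - a') / (1 + a) with hs
    have h1a : 0 < 1 + a := by linarith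
    have hs0 : 0 ≤ s := div_nonneg (by linarith) h1a.le
    have hs1 : s ≤ 1 := by rw [hs, div_le_one h1a]; linarith
    have hsa : s * (1 + a) = a - a' := by rw [hs]; field_simp
    have hconv : N (Pi.single i 1 - (1 + a') • Pi.single j 1 + v) ≤
        (1 - s) * N (Pi.single i 1 - (1 + a) • Pi.single j 1 + v) +
          s * N (Pi.single i 1 + v) := by
      have e : (Pi.single i 1 - (1 + a') • Pi.single j 1 + v : Fin k → ℝ) =
          (1 - s) • (Pi.single i 1 - (1 + a) • Pi.single j 1 + v) +
          s • (Pi.single i 1 + v) := by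
        have : 1 + a' = (1 - s) * (1 + a) := by linarith
        rw [this]
        module
      rw [e]
      refine (map_add_le_add N _ _).trans ?_
      rw [map_smul_eq_mul, map_smul_eq_mul, Real.norm_of_nonneg hs0,
        Real.norm_of_nonneg (sub_nonneg.2 hs1)]
    have hNv : N v ≤ 0.021 := by
      have := h.apply_le_of_abs_le hδ0 (by positivity)
        (fun l => (hv l).trans (by linarith : 2 * β ≤ 200 * β))
      rw [hk] at this
      linarith
    have hi1 := h.apply_single_le i
    have hlow := (abs_le.1 (h.abs_apply_single_sub_single hij)).1
    have hsqrt : 1.41 ≤ √2 := Real.le_sqrt_of_sq_le (by norm_num)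
    have hsqrt' : √2 ≤ 1.42 := by
      rw [Real.sqrt_le_left (by norm_num)]; norm_num
    have hP := apply_le_add N i j 0 a v
    have hPv : N (Pi.single i 1 - Pi.single j 1) ≤ N (Pi.single i 1 - Pi.single j 1 + v) + N v := by
      have := map_sub_le_add N (Pi.single i 1 - Pi.single j 1 + v) v
      rwa [add_sub_cancel_right] at this
    have hiv := map_add_le_add N (Pi.single i 1) v
    simp only [add_zero, one_smul, zero_sub, abs_neg] at hP
    have hNj : |a| * N (Pi.single j 1) ≤ 1.01 * β := by
      have := abs_nonneg a
      nlinarith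
    have hd : 0.3 ≤ N (Pi.single i 1 - (1 + a) • Pi.single j 1 + v) - N (Pi.single i 1 + v) := by
      nlinarith
    have : s * 0.3 ≤ s * (N (Pi.single i 1 - (1 + a) • Pi.single j 1 + v) -
        N (Pi.single i 1 + v)) := by gcongr
    nlinarith
  · have := apply_le_add N i j a a' v
    rw [abs_of_nonneg (sub_nonneg.2 haa')] at this
    nlinarith [sub_nonneg.2 haa']

/-- The candidate points: perturbed unit vectors with lower triangular perturbation. -/
def perturbedBasis {k : ℕ} (t : Fin k → Fin k → ℝ) (i : Fin k) : Fin k → ℝ :=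
  fun l => if l = i then 1 else if l < i then -t i l else 0

/-- The part of the difference of two candidate points away from their two main coordinates. -/
def offPart {k : ℕ} (t : Fin k → Fin k → ℝ) (i j : Fin k) : Fin k → ℝ :=
  fun l => if l = i ∨ l = j then 0 else perturbedBasis t i l - perturbedBasis t j l

lemma perturbedBasis_sub {k : ℕ} (t : Fin k → Fin k → ℝ) {i j : Fin k} (hij : j < i) :
    perturbedBasis t i - perturbedBasis t j =
      Pi.single i 1 - (1 + t i j) • Pi.single j 1 + offPart t i j := by
  ext l
  by_cases hl : l = i
  · subst hl
    simp [perturbedBasis, offPart, hij.ne', hij.le]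
  · by_cases hl' : l = j
    · subst hl'
      simp [perturbedBasis, offPart, hl, hij]
      ring
    · simp [offPart, hl, hl']

lemma abs_offPart_sub_le {k : ℕ} {t t' : Fin k → Fin k → ℝ} {d : ℝ}
    (h : ∀ i j, |t i j - t' i j| ≤ d) (i j l : Fin k) :
    |offPart t i j l - offPart t' i j l| ≤ 2 * d := by
  have hd : 0 ≤ d := (abs_nonneg _).trans (h i j)
  have hp : ∀ i, |perturbedBasis t i l - perturbedBasis t' i l| ≤ d := by
    intro i
    unfold perturbedBasis
    split_ifs
    · simpa
    · rw [neg_sub_neg, abs_sub_comm]; exact h i l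
    · simpa
  unfold offPart
  split_ifs
  · simpa using hd
  · calc _ = |(perturbedBasis t i l - perturbedBasis t' i l) -
          (perturbedBasis t j l - perturbedBasis t' j l)| := by congr 1; ring
      _ ≤ d + d := (abs_sub _ _).trans (add_le_add (hp i) (hp j))
      _ = 2 * d := by ring

lemma abs_offPart_le {k : ℕ} {t : Fin k → Fin k → ℝ} {d : ℝ}
    (h : ∀ i j, |t i j| ≤ d) {i j l : Fin k} : |offPart t i j l| ≤ 2 * d := by
  have h0 : offPart (0 : Fin k → Fin k → ℝ) i j l = 0 := by
    unfold offPart perturbedBasis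
    split_ifs <;> simp_all
  simpa [h0] using abs_offPart_sub_le (t' := 0) (by simpa using h) i j l

/-- Simplified Newton iteration for the system `N (p i - p j) = √2`. -/
noncomputable def newtonMap {k : ℕ} (N : Seminorm ℝ (Fin k → ℝ)) (t : Fin k → Fin k → ℝ) :
    Fin k → Fin k → ℝ :=
  fun i j => if j < i then t i j - (N (perturbedBasis t i - perturbedBasis t j) - √2) / 2 else 0

lemma abs_newtonMap_sub_le (hβ : 0 < β) (hβ' : β ≤ 1 / 10000) (hk : k * (200 * β) = 1 / 50)
    (h : N.AlmostEuclideanOnGrid (200 * β) (β / 25)) {t t' : Fin k → Fin k → ℝ}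
    (ht : ∀ i j, |t i j| ≤ β) (ht' : ∀ i j, |t' i j| ≤ β) {d : ℝ}
    (hd : ∀ i j, |t i j - t' i j| ≤ d) (hdβ : d ≤ 2 * β) (i j : Fin k) :
    |newtonMap N t i j - newtonMap N t' i j| ≤ 15 / 16 * d := by
  have hd0 : 0 ≤ d := (abs_nonneg _).trans (hd i j)
  unfold newtonMap
  split_ifs with hij
  swap
  · simpa
  rw [perturbedBasis_sub t hij, perturbedBasis_sub t' hij]
  have hne : i ≠ j := hij.ne'
  have hoi : ∀ t : Fin k → Fin k → ℝ, offPart t i j i = 0 := by simp [offPart]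
  have hoj : ∀ t : Fin k → Fin k → ℝ, offPart t i j j = 0 := by simp [offPart]
  have hov := fun l => abs_offPart_le ht (i := i) (j := j) (l := l)
  have hov' := fun l => abs_offPart_le ht' (i := i) (j := j) (l := l)
  have hsub := abs_offPart_sub_le hd i j
  have hc1 := apply_sub_apply_le hβ hβ' hk h hne (ht' i j) (hoi t) (hoj t) (hoi t') (hoj t')
    hov' hsub (by linarith)
  have hc2 := apply_sub_apply_le hβ hβ' hk h hne (ht' i j) (hoi t') (hoj t') (hoi t) (hoj t)
    hov (fun l => by rw [abs_sub_comm]; exact hsub l) (by linarith)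
  have hdij := abs_le.1 (hd i j)
  rw [abs_le]
  rcases le_total (t' i j) (t i j) with hle | hle
  · have := slope_bounds hβ hβ' hk h hne (ht i j) hle (ht' i j) hov
    constructor <;> linarith [this.1, this.2]
  · have := slope_bounds hβ hβ' hk h hne (ht' i j) hle (ht i j) hov
    constructor <;> linarith [this.1, this.2]

/-- A seminorm which is sufficiently close to the Euclidean norm on a grid has `k` points at
mutual distance `√2`. -/
theorem exists_equilateral (hβ : 0 < β) (hβ' : β ≤ 1 / 10000) (hk : k * (200 * β) = 1 / 50)
    (h : N.AlmostEuclideanOnGrid (200 * β) (β / 25)) :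
    ∃ p : Fin k → Fin k → ℝ, ∀ i j, i ≠ j → N (p i - p j) = √2 := by
  have hmem : ∀ t : Fin k → Fin k → ℝ,
      t ∈ Metric.closedBall (0 : Fin k → Fin k → ℝ) β ↔ ∀ i j, |t i j| ≤ β := by
    intro t
    simp only [mem_closedBall_zero_iff, pi_norm_le_iff_of_nonneg hβ.le, Real.norm_eq_abs]
  have hdist : ∀ t t' : Fin k → Fin k → ℝ, ∀ i j, |t i j - t' i j| ≤ dist t t' := by
    intro t t' i j
    exact (dist_le_pi_dist (t i) (t' i) j).trans (dist_le_pi_dist t t' i)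
  have hzero : ∀ i j, |newtonMap N 0 i j| ≤ 1 / 16 * β := by
    intro i j
    unfold newtonMap
    split_ifs with hij
    · rw [perturbedBasis_sub _ hij]
      have h0 : offPart (0 : Fin k → Fin k → ℝ) i j = 0 := by
        ext l
        simpa using abs_offPart_le (t := (0 : Fin k → Fin k → ℝ)) (d := 0) (by simp)
          (i := i) (j := j) (l := l)
      have hN := h.abs_apply_single_sub_single hij.ne'
      have hsqrt : √2 ≤ 1.42 := by
        rw [Real.sqrt_le_left (by norm_num)]; norm_num
      simp only [h0, Pi.zero_apply, add_zero, one_smul, zero_sub, abs_neg, abs_div]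
      norm_num
      nlinarith
    · simp [hβ.le]
  have hmaps : Set.MapsTo (newtonMap N) (Metric.closedBall 0 β) (Metric.closedBall 0 β) := by
    intro t ht
    rw [hmem] at ht ⊢
    intro i j
    have := abs_newtonMap_sub_le hβ hβ' hk h ht (t' := 0) (fun _ _ => by simpa using hβ.le)
      (d := β) (by simpa using ht) (by linarith) i j
    calc |newtonMap N t i j| ≤ |newtonMap N t i j - newtonMap N 0 i j| + |newtonMap N 0 i j| := by
          simpa using abs_add_le (newtonMap N t i j - newtonMap N 0 i j) (newtonMap N 0 i j)
      _ ≤ β := by linarith [hzero i j]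
  have hcontr : ContractingWith (15 / 16) (hmaps.restrict (newtonMap N) _ _) := by
    refine ⟨?_, LipschitzWith.of_dist_le_mul fun t t' => ?_⟩
    · rw [← NNReal.coe_lt_coe]; norm_num
    · have ht := (hmem t).1 t.2
      have ht' := (hmem t').1 t'.2
      have hle : dist (t : Fin k → Fin k → ℝ) t' ≤ 2 * β := by
        have := dist_triangle_right (t : Fin k → Fin k → ℝ) t' 0
        linarith [Metric.mem_closedBall.1 t.2, Metric.mem_closedBall.1 t'.2]
      have hnn : 0 ≤ 15 / 16 * dist (t : Fin k → Fin k → ℝ) t' := by positivity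
      have hcoe : ((15 / 16 : NNReal) : ℝ) = 15 / 16 := by norm_num
      rw [hcoe, Subtype.dist_eq, Subtype.dist_eq]
      refine (dist_pi_le_iff hnn).2 fun i => (dist_pi_le_iff hnn).2 fun j => ?_
      exact abs_newtonMap_sub_le hβ hβ' hk h ht ht' (hdist _ _) hle i j
  obtain ⟨t, -, htfix, -⟩ := hcontr.exists_fixedPoint' Metric.isClosed_closedBall.isComplete hmaps
    (Metric.mem_closedBall_self hβ.le) (edist_ne_top _ _)
  have key : ∀ i j, j < i → N (perturbedBasis t i - perturbedBasis t j) = √2 := by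
    intro i j hij
    have := congrFun (congrFun htfix i) j
    simp only [newtonMap, if_pos hij] at this
    linarith
  refine ⟨perturbedBasis t, fun i j hij => ?_⟩
  rcases hij.lt_or_gt with hlt | hlt
  · rw [map_sub_rev, key j i hlt]
  · exact key i j hlt

end Seminorm.AlmostEuclideanOnGrid

section DvoretzkyRogers

open Module

variable {V : Type*} [NormedAddCommGroup V] [InnerProductSpace ℝ V] [FiniteDimensional ℝ V]
  {X : Type*} [NormedAddCommGroup X] [NormedSpace ℝ X]

/-- The linear map acting as multiplication by `a` on `U` and by `b` on `Uᗮ` has the expected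
determinant. -/
lemma exists_linearMap_dilation (U : Submodule ℝ V) (a b : ℝ) :
    ∃ Q : V →ₗ[ℝ] V, (∀ u ∈ U, ∀ w ∈ Uᗮ, Q (u + w) = a • u + b • w) ∧
      LinearMap.det Q = a ^ finrank ℝ U * b ^ finrank ℝ Uᗮ := by
  let e := U.prodEquivOfIsCompl _ U.isCompl_orthogonal
  let D : (U × Uᗮ) →ₗ[ℝ] (U × Uᗮ) :=
    LinearMap.prodMap (a • LinearMap.id) (b • LinearMap.id)
  refine ⟨(e : (U × Uᗮ) →ₗ[ℝ] V) ∘ₗ D ∘ₗ (e.symm : V →ₗ[ℝ] U × Uᗮ), fun u hu w hw => ?_, ?_⟩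
  · have : e.symm (u + w) = (⟨u, hu⟩, ⟨w, hw⟩) := by
      rw [LinearEquiv.symm_apply_eq]; rfl
    rw [LinearMap.comp_apply, LinearMap.comp_apply, LinearEquiv.coe_coe, LinearEquiv.coe_coe, this]
    rfl
  · rw [LinearMap.det_conj, LinearMap.det_prodMap]
    simp

/-- A contraction of maximal determinant from a Euclidean space does not shrink any subspace of
more than half the dimension by a factor `2`. -/
lemma exists_half_le_norm_of_isMaxOn (e : V ≃ₗ[ℝ] X) (S : V →ₗ[ℝ] V)
    (hS : ∀ v, ‖e (S v)‖ ≤ ‖v‖) (hdet : 0 < |LinearMap.det S|)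
    (hmax : ∀ R : V →ₗ[ℝ] V, (∀ v, ‖e (R v)‖ ≤ ‖v‖) → |LinearMap.det R| ≤ |LinearMap.det S|)
    (U : Submodule ℝ V) (hU : finrank ℝ V < 2 * finrank ℝ U) :
    ∃ u ∈ U, ‖u‖ = 1 ∧ 1 / 2 ≤ ‖e (S u)‖ := by
  by_contra! hcon
  have hhalf : ∀ u ∈ U, ‖e (S u)‖ ≤ 1 / 2 * ‖u‖ := by
    intro u hu
    by_cases h0 : u = 0
    · simp [h0]
    have hn : 0 < ‖u‖ := norm_pos_iff.2 h0
    have := hcon (‖u‖⁻¹ • u) (U.smul_mem _ hu) (by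
      rw [norm_smul, norm_inv, norm_norm, inv_mul_cancel₀ hn.ne'])
    rw [map_smul, map_smul, norm_smul, norm_inv, norm_norm, inv_mul_lt_iff₀ hn] at this
    linarith
  obtain ⟨Q, hQ, hQdet⟩ := exists_linearMap_dilation U (√2) (√2)⁻¹
  have hcontr : ∀ v, ‖e ((S ∘ₗ Q) v)‖ ≤ ‖v‖ := by
    intro v
    obtain ⟨u, hu, w, hw, rfl⟩ := U.exists_add_mem_mem_orthogonal v
    have hpyth : ‖u + w‖ ^ 2 = ‖u‖ ^ 2 + ‖w‖ ^ 2 := by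
      have := norm_add_sq_eq_norm_sq_add_norm_sq_of_inner_eq_zero u w (hw u hu)
      simpa [pow_two] using this
    have hsq : √2 * √2 = 2 := Real.mul_self_sqrt (by norm_num)
    have hs0 : 0 < √2 := by positivity
    have hinv : (√2)⁻¹ = √2 / 2 := by field_simp; linarith
    have h1 : ‖e ((S ∘ₗ Q) (u + w))‖ ≤ √2 / 2 * (‖u‖ + ‖w‖) := by
      rw [LinearMap.comp_apply, hQ u hu w hw]
      simp only [map_add, map_smul]
      refine (norm_add_le _ _).trans ?_
      rw [norm_smul, norm_smul, Real.norm_of_nonneg hs0.le,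
        Real.norm_of_nonneg (inv_nonneg.2 hs0.le), hinv]
      nlinarith [hhalf u hu, hS w]
    refine h1.trans (abs_le_of_sq_le_sq' ?_ (norm_nonneg _)).2
    rw [hpyth]
    nlinarith [sq_nonneg (‖u‖ - ‖w‖)]
  have hle := hmax (S ∘ₗ Q) hcontr
  rw [LinearMap.det_comp, abs_mul] at hle
  have hfin := U.finrank_add_finrank_orthogonal
  have hgt : 1 < |LinearMap.det Q| := by
    rw [hQdet, inv_pow, ← div_eq_mul_inv, abs_of_pos (by positivity), one_lt_div (by positivity)]
    exact pow_lt_pow_right₀ (by rw [Real.lt_sqrt] <;> norm_num) (by omega)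
  nlinarith

lemma exists_isMaxOn_det (e : V ≃ₗ[ℝ] X) :
    ∃ S : V →ₗ[ℝ] V, (∀ v, ‖e (S v)‖ ≤ ‖v‖) ∧ 0 < |LinearMap.det S| ∧
      ∀ R : V →ₗ[ℝ] V, (∀ v, ‖e (R v)‖ ≤ ‖v‖) → |LinearMap.det R| ≤ |LinearMap.det S| := by
  have : FiniteDimensional ℝ X := Module.Finite.equiv e
  let ec := e.toContinuousLinearEquiv
  have hec : ∀ v, ec v = e v := fun _ => rfl
  let K : Set (V →L[ℝ] V) := {S | ∀ v, ‖ec (S v)‖ ≤ ‖v‖}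
  have hclosed : IsClosed K := by
    have : K = ⋂ v, {S : V →L[ℝ] V | ‖ec (S v)‖ ≤ ‖v‖} := by ext; simp [K]
    rw [this]
    exact isClosed_iInter fun v => isClosed_le (by fun_prop) continuous_const
  have hbdd : Bornology.IsBounded K := by
    refine (Metric.isBounded_closedBall (x := (0 : V →L[ℝ] V))
      (r := ‖(ec.symm : X →L[ℝ] V)‖)).subset fun S hS => ?_
    rw [mem_closedBall_zero_iff]
    refine S.opNorm_le_bound (norm_nonneg _) fun v => ?_
    calc ‖S v‖ = ‖(ec.symm : X →L[ℝ] V) (ec (S v))‖ := by simp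
      _ ≤ ‖(ec.symm : X →L[ℝ] V)‖ * ‖ec (S v)‖ := ContinuousLinearMap.le_opNorm _ _
      _ ≤ _ := by gcongr; exact hS v
  have hprop : ProperSpace (V →L[ℝ] V) := FiniteDimensional.proper ℝ _
  have hcomp : IsCompact K := Metric.isCompact_of_isClosed_isBounded hclosed hbdd
  have hcont : Continuous fun S : V →L[ℝ] V => |S.det| :=
    continuous_abs.comp ContinuousLinearMap.continuous_det
  have hscale : (‖(ec : V →L[ℝ] X)‖ + 1)⁻¹ • ContinuousLinearMap.id ℝ V ∈ K := by
    intro v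
    have hpos : 0 < ‖(ec : V →L[ℝ] X)‖ + 1 := by positivity
    have := (ec : V →L[ℝ] X).le_opNorm v
    simp only [ContinuousLinearEquiv.coe_coe] at this
    simp only [smul_apply, ContinuousLinearMap.id_apply, map_smul, norm_smul,
      norm_inv, Real.norm_of_nonneg hpos.le]
    rw [inv_mul_le_iff₀ hpos]
    nlinarith [norm_nonneg v]
  obtain ⟨S, hSK, hSmax⟩ := hcomp.exists_isMaxOn ⟨_, hscale⟩ hcont.continuousOn
  refine ⟨S, hSK, lt_of_lt_of_le ?_ (hSmax hscale), fun R hR => ?_⟩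
  · simp only [ContinuousLinearMap.det, abs_pos]
    have hne : (‖(ec : V →L[ℝ] X)‖ + 1)⁻¹ ≠ 0 := by positivity
    rw [ContinuousLinearMap.toLinearMap_smul, LinearMap.det_smul]
    exact mul_ne_zero (pow_ne_zero _ hne) (by simp)
  · exact hSmax (a := R.toContinuousLinearMap) hR

/-- A weak form of the Dvoretzky–Rogers lemma. -/
theorem exists_contraction_half_le_norm_single [FiniteDimensional ℝ X] :
    ∃ m : ℕ, finrank ℝ X ≤ 2 * m ∧ ∃ T : EuclideanSpace ℝ (Fin m) →ₗ[ℝ] X,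
      (∀ z, ‖T z‖ ≤ ‖z‖) ∧ ∀ i, 1 / 2 ≤ ‖T (EuclideanSpace.single i 1)‖ := by
  set n := finrank ℝ X with hn
  let e : EuclideanSpace ℝ (Fin n) ≃ₗ[ℝ] X := LinearEquiv.ofFinrankEq _ _ (by simp [hn])
  obtain ⟨S, hS, hdet, hmax⟩ := exists_isMaxOn_det e
  have hind : ∀ m : ℕ, 2 * m ≤ n + 1 → ∃ u : Fin m → EuclideanSpace ℝ (Fin n),
      Orthonormal ℝ u ∧ ∀ i, 1 / 2 ≤ ‖e (S (u i))‖ := by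
    intro m
    induction m with
    | zero => exact fun _ => ⟨Fin.elim0, Orthonormal.of_isEmpty _, fun i => i.elim0⟩
    | succ m ih =>
      intro hm
      obtain ⟨u, hu, hhalf⟩ := ih (by omega)
      have hdim := (Submodule.span ℝ (Set.range u)).finrank_add_finrank_orthogonal
      rw [finrank_span_eq_card hu.linearIndependent, Fintype.card_fin,
        finrank_euclideanSpace_fin] at hdim
      obtain ⟨w, hw, hw1, hw2⟩ := exists_half_le_norm_of_isMaxOn e S hS hdet hmax
        (Submodule.span ℝ (Set.range u))ᗮ (by rw [finrank_euclideanSpace_fin]; omega)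
      refine ⟨Matrix.vecCons w u, orthonormal_vecCons_iff.2 ⟨hw1, fun i => ?_, hu⟩, fun i => ?_⟩
      · rw [real_inner_comm]
        exact hw _ (Submodule.subset_span ⟨i, rfl⟩)
      · refine Fin.cases ?_ (fun i => ?_) i
        · simpa using hw2
        · simpa using hhalf i
  obtain ⟨u, hu, hhalf⟩ := hind ((n + 1) / 2) (by omega)
  let L : EuclideanSpace ℝ (Fin ((n + 1) / 2)) →ₗ[ℝ] EuclideanSpace ℝ (Fin n) :=
    Fintype.linearCombination ℝ u ∘ₗ (WithLp.linearEquiv 2 ℝ (Fin ((n + 1) / 2) → ℝ)).toLinearMap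
  have hL : ∀ z, L z = ∑ i, z i • u i := fun z => by
    simp [L, Fintype.linearCombination_apply]
  refine ⟨(n + 1) / 2, by omega, e.toLinearMap ∘ₗ S ∘ₗ L, fun z => ?_, fun i => ?_⟩
  · refine (hS (L z)).trans (le_of_eq ?_)
    have hsq : ‖L z‖ ^ 2 = ‖z‖ ^ 2 := by
      rw [hL, ← real_inner_self_eq_norm_sq, hu.inner_sum, EuclideanSpace.real_norm_sq_eq]
      simp [pow_two]
    exact (pow_left_inj₀ (norm_nonneg _) (norm_nonneg _) two_ne_zero).1 hsq
  · have : L (EuclideanSpace.single i 1) = u i := by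
      rw [hL, Finset.sum_eq_single i] <;> simp +contextual
    simpa [this] using hhalf i

end DvoretzkyRogers

section GaussianConcentration

open MeasureTheory ProbabilityTheory Real Filter Topology

variable {E : Type*} [NormedAddCommGroup E] [InnerProductSpace ℝ E] [FiniteDimensional ℝ E]
  [MeasurableSpace E] [BorelSpace E] {X : Type*} [NormedAddCommGroup X] [NormedSpace ℝ X]

lemma integrable_exp_mul_norm_stdGaussian (c : ℝ) :
    Integrable (fun x : E => exp (c * ‖x‖)) (stdGaussian E) := by
  obtain ⟨C, hC, hint⟩ := IsGaussian.exists_integrable_exp_sq (stdGaussian E)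
  refine (hint.const_mul (exp (c ^ 2 / (4 * C)))).mono' (by fun_prop) (.of_forall fun x => ?_)
  rw [norm_of_nonneg (exp_pos _).le, ← exp_add]
  gcongr
  have h : c ^ 2 / (4 * C) + C * ‖x‖ ^ 2 - c * ‖x‖ = (c - 2 * C * ‖x‖) ^ 2 / (4 * C) := by
    field_simp; ring
  have : 0 ≤ (c - 2 * C * ‖x‖) ^ 2 / (4 * C) := by positivity
  linarith

lemma integrable_exp_mul_norm_apply_stdGaussian (T : E →L[ℝ] X) (c : ℝ) :
    Integrable (fun x : E => exp (c * ‖T x‖)) (stdGaussian E) := by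
  refine (integrable_exp_mul_norm_stdGaussian (E := E) (|c| * ‖T‖)).mono' (by fun_prop)
    (.of_forall fun x => ?_)
  rw [norm_of_nonneg (exp_pos _).le]
  refine exp_le_exp.2 ?_
  calc c * ‖T x‖ ≤ |c| * ‖T x‖ := by gcongr; exact le_abs_self c
    _ ≤ |c| * (‖T‖ * ‖x‖) := by gcongr; exact T.le_opNorm x
    _ = |c| * ‖T‖ * ‖x‖ := by ring

lemma integral_exp_mul_strongDual_stdGaussian (L : StrongDual ℝ E) (c : ℝ) :
    ∫ y, exp (c * L y) ∂(stdGaussian E) = exp (c ^ 2 * ‖L‖ ^ 2 / 2) := by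
  have := mgf_gaussianReal (IsGaussian.map_eq_gaussianReal (μ := stdGaussian E) L) c
  rw [variance_dual_stdGaussian, integral_strongDual_stdGaussian, mgf] at this
  rw [this, Real.coe_toNNReal _ (sq_nonneg _)]
  ring_nf

lemma integrable_exp_mul_strongDual_stdGaussian (L : StrongDual ℝ E) (c : ℝ) :
    Integrable (fun y => exp (c * L y)) (stdGaussian E) :=
  not_imp_comm.1 integral_undef (by
    rw [integral_exp_mul_strongDual_stdGaussian]; exact exp_ne_zero _)

/-- One infinitesimal rotation step in the proof of Gaussian concentration for norms. -/
lemma integral_exp_norm_sub_norm_rotation_le (T : E →L[ℝ] X) {l h : ℝ} (hl : 0 ≤ l) :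
    ∫ z, exp (l * (‖T z.1‖ - ‖T (cos h • z.1 - sin h • z.2)‖))
        ∂((stdGaussian E).prod (stdGaussian E)) ≤
      exp ((l * sin h) ^ 2 * ‖T‖ ^ 2 / 2) *
        ∫ x, exp (l * (1 - cos h) * ‖T x‖) ∂(stdGaussian E) := by
  have hint : Integrable (fun z : E × E =>
      exp (l * (‖T z.1‖ - ‖T (cos h • z.1 - sin h • z.2)‖)))
      ((stdGaussian E).prod (stdGaussian E)) := by
    refine ((integrable_exp_mul_norm_apply_stdGaussian T l).mul_prod
      (integrable_const (1 : ℝ))).mono' (by fun_prop) (.of_forall fun z => ?_)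
    rw [norm_of_nonneg (exp_pos _).le, mul_one]
    gcongr
    linarith [norm_nonneg (T (cos h • z.1 - sin h • z.2))]
  rw [integral_prod _ hint, ← integral_const_mul]
  refine integral_mono hint.integral_prod_left
    ((integrable_exp_mul_norm_apply_stdGaussian T _).const_mul _) fun x => ?_
  obtain ⟨g, hg, hgx⟩ := exists_dual_vector'' ℝ (T x)
  simp only [RCLike.ofReal_real_eq_id, id_eq] at hgx
  set L : StrongDual ℝ E := g.comp T with hL
  have hLn : ‖L‖ ≤ ‖T‖ := by
    calc ‖L‖ ≤ ‖g‖ * ‖T‖ := g.opNorm_comp_le T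
      _ ≤ 1 * ‖T‖ := by gcongr
      _ = ‖T‖ := one_mul _
  have hpt : ∀ y, exp (l * (‖T x‖ - ‖T (cos h • x - sin h • y)‖)) ≤
      exp (l * (1 - cos h) * ‖T x‖) * exp (l * sin h * L y) := by
    intro y
    rw [← exp_add]
    gcongr
    have hle : g (T (cos h • x - sin h • y)) ≤ ‖T (cos h • x - sin h • y)‖ := by
      refine (le_abs_self _).trans ((g.le_opNorm _).trans ?_)
      exact (mul_le_mul_of_nonneg_right hg (norm_nonneg _)).trans_eq (one_mul _)
    have he : g (T (cos h • x - sin h • y)) = cos h * ‖T x‖ - sin h * L y := by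
      simp [hL, hgx]
    nlinarith
  calc ∫ y, exp (l * (‖T x‖ - ‖T (cos h • x - sin h • y)‖)) ∂(stdGaussian E)
      ≤ ∫ y, exp (l * (1 - cos h) * ‖T x‖) * exp (l * sin h * L y) ∂(stdGaussian E) := by
        refine integral_mono_of_nonneg (.of_forall fun y => (exp_pos _).le)
          ((integrable_exp_mul_strongDual_stdGaussian L _).const_mul _) (.of_forall hpt)
    _ = exp (l * (1 - cos h) * ‖T x‖) * exp ((l * sin h) ^ 2 * ‖L‖ ^ 2 / 2) := by
        rw [integral_const_mul, integral_exp_mul_strongDual_stdGaussian]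
    _ ≤ exp ((l * sin h) ^ 2 * ‖T‖ ^ 2 / 2) * exp (l * (1 - cos h) * ‖T x‖) := by
        rw [mul_comm]
        gcongr

/-- Discretised Maurey–Pisier rotation argument. -/
lemma integral_exp_mul_integral_exp_neg_le_of_nat (T : E →L[ℝ] X) {l : ℝ} (hl : 0 ≤ l) {K : ℕ}
    (hK : 0 < K) :
    (∫ x, exp (l * ‖T x‖) ∂(stdGaussian E)) * (∫ x, exp (-l * ‖T x‖) ∂(stdGaussian E)) ≤
      exp (3 * l ^ 2 * ‖T‖ ^ 2 / 2) *
        ∫ x, exp (2 * l / K * ‖T x‖) ∂(stdGaussian E) := by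
  set γ := stdGaussian E
  have hK' : (0 : ℝ) < K := by exact_mod_cast hK
  set h : ℝ := π / 2 / K with hh
  have hh0 : 0 ≤ h := by positivity
  have hKh : K * h = π / 2 := by rw [hh]; field_simp
  have hhπ : h ≤ π := by
    have : (1 : ℝ) ≤ K := by exact_mod_cast hK
    nlinarith [pi_pos]
  have hsin : 0 ≤ sin h := sin_nonneg_of_nonneg_of_le_pi hh0 hhπ
  let φ : E × E → ℝ := fun z => exp (l * K * (‖T z.1‖ - ‖T (cos h • z.1 - sin h • z.2)‖))
  let P : ℕ → E × E → E := fun j z => cos (j * h) • z.1 + sin (j * h) • z.2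
  have hφ : Continuous φ := by fun_prop
  have hrot : ∀ (j : ℕ) (z : E × E), φ (ContinuousLinearMap.rotation (((j + 1 : ℕ) : ℝ) * h) z) =
      exp (l * K * (‖T (P (j + 1) z)‖ - ‖T (P j z)‖)) := by
    intro j z
    have hcos : cos (j * h) = cos (((j + 1 : ℕ) : ℝ) * h) * cos h +
        sin (((j + 1 : ℕ) : ℝ) * h) * sin h := by
      rw [← cos_sub]; congr 1; push_cast; ring
    have hsn : sin (j * h) = sin (((j + 1 : ℕ) : ℝ) * h) * cos h -
        cos (((j + 1 : ℕ) : ℝ) * h) * sin h := by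
      rw [← sin_sub]; congr 1; push_cast; ring
    have : P j z = cos h • (ContinuousLinearMap.rotation (((j + 1 : ℕ) : ℝ) * h) z).1 -
        sin h • (ContinuousLinearMap.rotation (((j + 1 : ℕ) : ℝ) * h) z).2 := by
      simp only [P, ContinuousLinearMap.rotation_apply, hcos, hsn]
      module
    rw [this]
    simp [φ, P, ContinuousLinearMap.rotation_apply]
  have hpres : ∀ θ : ℝ, (γ.prod γ).map (ContinuousLinearMap.rotation θ) = γ.prod γ :=
    IsGaussian.map_rotation_eq_self (by simp [γ])
  have hφint : Integrable φ (γ.prod γ) := by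
    refine ((integrable_exp_mul_norm_apply_stdGaussian T (l * K)).mul_prod
      (integrable_const (1 : ℝ))).mono' (by fun_prop) (.of_forall fun z => ?_)
    rw [norm_of_nonneg (exp_pos _).le, mul_one]
    refine exp_le_exp.2 (mul_le_mul_of_nonneg_left ?_ (by positivity))
    linarith [norm_nonneg (T (cos h • z.1 - sin h • z.2))]
  have hstep_int : ∀ j : ℕ, Integrable
      (fun z => exp (l * K * (‖T (P (j + 1) z)‖ - ‖T (P j z)‖))) (γ.prod γ) := by
    intro j
    simp only [← hrot]
    refine Integrable.comp_measurable (g := φ)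
      (f := ContinuousLinearMap.rotation (E := E) (((j + 1 : ℕ) : ℝ) * h)) ?_
      (ContinuousLinearMap.continuous _).measurable
    rwa [hpres]
  have hstep : ∀ j : ℕ, ∫ z, exp (l * K * (‖T (P (j + 1) z)‖ - ‖T (P j z)‖)) ∂(γ.prod γ) =
      ∫ z, φ z ∂(γ.prod γ) := by
    intro j
    simp only [← hrot]
    rw [← integral_map (φ := ContinuousLinearMap.rotation (E := E) (((j + 1 : ℕ) : ℝ) * h))
      (ContinuousLinearMap.continuous _).aemeasurable
      (by rw [hpres]; exact hφ.aestronglyMeasurable), hpres]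
  have hjensen : ∀ z : E × E, exp (-l * ‖T z.1‖) * exp (l * ‖T z.2‖) ≤
      ∑ j ∈ Finset.range K, (K : ℝ)⁻¹ * exp (l * K * (‖T (P (j + 1) z)‖ - ‖T (P j z)‖)) := by
    intro z
    have hconv := convexOn_exp.map_sum_le (t := Finset.range K) (w := fun _ => (K : ℝ)⁻¹)
      (p := fun j => l * K * (‖T (P (j + 1) z)‖ - ‖T (P j z)‖)) (fun _ _ => by positivity)
      (by simp [hK'.ne']) (fun _ _ => Set.mem_univ _)
    simp only [smul_eq_mul] at hconv
    refine le_trans (le_of_eq ?_) hconv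
    rw [← exp_add]
    congr 1
    have htel := Finset.sum_range_sub (fun j => ‖T (P j z)‖) K
    have h0 : P 0 z = z.1 := by simp [P]
    have h1 : P K z = z.2 := by simp [P, hKh]
    rw [h0, h1] at htel
    calc -l * ‖T z.1‖ + l * ‖T z.2‖ = l * (‖T z.2‖ - ‖T z.1‖) := by ring
      _ = _ := by
        rw [← htel, Finset.mul_sum]
        refine Finset.sum_congr rfl fun j _ => ?_
        field_simp
  have hmul : l * K * sin h ≤ l * (π / 2) := by
    rw [mul_assoc, ← hKh]
    gcongr
    exact sin_le hh0
  have hpi2 : π ^ 2 ≤ 12 := by nlinarith [pi_lt_d2, pi_pos]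
  calc (∫ x, exp (l * ‖T x‖) ∂γ) * (∫ x, exp (-l * ‖T x‖) ∂γ)
      = ∫ z : E × E, exp (-l * ‖T z.1‖) * exp (l * ‖T z.2‖) ∂(γ.prod γ) := by
        rw [integral_prod_mul (fun x => exp (-l * ‖T x‖)) (fun x => exp (l * ‖T x‖)), mul_comm]
    _ ≤ ∫ z : E × E, ∑ j ∈ Finset.range K,
          (K : ℝ)⁻¹ * exp (l * K * (‖T (P (j + 1) z)‖ - ‖T (P j z)‖)) ∂(γ.prod γ) := by
        refine integral_mono_of_nonneg (.of_forall fun z => by positivity)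
          (integrable_finsetSum _ fun j _ => (hstep_int j).const_mul _) (.of_forall hjensen)
    _ = ∫ z, φ z ∂(γ.prod γ) := by
        rw [integral_finsetSum _ fun j _ => (hstep_int j).const_mul _]
        simp only [integral_const_mul, hstep, Finset.sum_const, Finset.card_range, nsmul_eq_mul]
        field_simp
    _ ≤ exp ((l * K * sin h) ^ 2 * ‖T‖ ^ 2 / 2) *
          ∫ x, exp (l * K * (1 - cos h) * ‖T x‖) ∂γ :=
        integral_exp_norm_sub_norm_rotation_le T (by positivity)
    _ ≤ _ := by
        gcongr ?_ * ?_
        · gcongr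
          have : (l * K * sin h) ^ 2 ≤ (l * (π / 2)) ^ 2 :=
            pow_le_pow_left₀ (by positivity) hmul 2
          nlinarith [sq_nonneg l]
        · refine integral_mono (integrable_exp_mul_norm_apply_stdGaussian T _)
            (integrable_exp_mul_norm_apply_stdGaussian T _) fun x => ?_
          dsimp only
          gcongr
          have hc := one_sub_sq_div_two_le_cos (x := h)
          rw [mul_assoc, mul_comm 2 l, mul_div_assoc]
          gcongr
          calc K * (1 - cos h) ≤ K * (h ^ 2 / 2) := by gcongr; linarith
            _ = π ^ 2 / 8 / K := by rw [hh]; field_simp; ring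
            _ ≤ 2 / K := by gcongr; linarith

lemma integral_exp_mul_integral_exp_neg_le (T : E →L[ℝ] X) (l : ℝ) :
    (∫ x, exp (l * ‖T x‖) ∂(stdGaussian E)) * (∫ x, exp (-l * ‖T x‖) ∂(stdGaussian E)) ≤
      exp (3 * l ^ 2 * ‖T‖ ^ 2 / 2) := by
  wlog hl : 0 ≤ l generalizing l
  · have := this (-l) (by linarith)
    rwa [neg_neg, neg_sq, mul_comm] at this
  have hlim : Tendsto (fun K : ℕ => ∫ x, exp (2 * l / K * ‖T x‖) ∂(stdGaussian E)) atTop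
      (𝓝 (∫ _, 1 ∂(stdGaussian E))) := by
    refine tendsto_integral_filter_of_dominated_convergence (fun x => exp (2 * l * ‖T x‖))
      (.of_forall fun K => by fun_prop) ?_ (integrable_exp_mul_norm_apply_stdGaussian T _)
      (.of_forall fun x => ?_)
    · filter_upwards [eventually_ge_atTop 1] with K hK
      refine .of_forall fun x => ?_
      rw [norm_of_nonneg (exp_pos _).le]
      gcongr
      exact div_le_self (by positivity) (by exact_mod_cast hK)
    · have h0 : Tendsto (fun K : ℕ => 2 * l / K * ‖T x‖) atTop (𝓝 (0 * ‖T x‖)) :=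
        (tendsto_const_div_atTop_nhds_zero_nat _).mul_const _
      have := (continuous_exp.tendsto _).comp h0
      simpa [Function.comp_def] using this
  have := hlim.const_mul (exp (3 * l ^ 2 * ‖T‖ ^ 2 / 2))
  simp only [integral_const, probReal_univ, smul_eq_mul, mul_one] at this
  refine ge_of_tendsto this ?_
  filter_upwards [eventually_gt_atTop 0] with K hK
  exact integral_exp_mul_integral_exp_neg_le_of_nat T hl hK

lemma integrable_norm_apply_stdGaussian (T : E →L[ℝ] X) :
    Integrable (fun x => ‖T x‖) (stdGaussian E) :=
  (integrable_exp_mul_norm_apply_stdGaussian T 1).mono' (by fun_prop) (.of_forall fun x => by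
    rw [norm_norm, one_mul]; linarith [add_one_le_exp ‖T x‖])

lemma hasSubgaussianMGF_norm_apply_stdGaussian (T : E →L[ℝ] X) :
    HasSubgaussianMGF (fun x => ‖T x‖ - ∫ y, ‖T y‖ ∂(stdGaussian E)) (3 * ‖T‖₊ ^ 2)
      (stdGaussian E) := by
  set D := ∫ y, ‖T y‖ ∂(stdGaussian E) with hD
  have heq : ∀ t : ℝ, (fun x : E => exp (t * (‖T x‖ - D))) =
      fun x => exp (-t * D) * exp (t * ‖T x‖) := by
    intro t
    ext x
    rw [← exp_add]
    congr 1
    ring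
  refine ⟨fun t => ?_, fun t => ?_⟩
  · rw [heq]
    exact (integrable_exp_mul_norm_apply_stdGaussian T t).const_mul _
  · rw [mgf, heq, integral_const_mul]
    have hj : exp (-t * D) ≤ ∫ y, exp (-t * ‖T y‖) ∂(stdGaussian E) := by
      rw [hD, ← integral_const_mul]
      exact convexOn_exp.map_integral_le continuous_exp.continuousOn isClosed_univ (by simp)
        ((integrable_norm_apply_stdGaussian T).const_mul _)
        (integrable_exp_mul_norm_apply_stdGaussian T _)
    calc exp (-t * D) * ∫ x, exp (t * ‖T x‖) ∂(stdGaussian E)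
        ≤ (∫ y, exp (-t * ‖T y‖) ∂(stdGaussian E)) * ∫ x, exp (t * ‖T x‖) ∂(stdGaussian E) := by
          gcongr
      _ ≤ exp (3 * t ^ 2 * ‖T‖ ^ 2 / 2) := by
          rw [mul_comm]; exact integral_exp_mul_integral_exp_neg_le T t
      _ = _ := by push_cast; ring_nf

/-- Gaussian concentration for the norm of a linear image. -/
theorem measureReal_abs_norm_sub_integral_ge_le (T : E →L[ℝ] X) {s : ℝ} (hs : 0 ≤ s) :
    (stdGaussian E).real {x | s ≤ |‖T x‖ - ∫ y, ‖T y‖ ∂(stdGaussian E)|} ≤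
      2 * exp (-s ^ 2 / (6 * ‖T‖ ^ 2)) := by
  have h := hasSubgaussianMGF_norm_apply_stdGaussian T
  have h1 := h.measure_ge_le hs
  have h2 := h.neg.measure_ge_le hs
  have hc : 2 * ((3 * ‖T‖₊ ^ 2 : NNReal) : ℝ) = 6 * ‖T‖ ^ 2 := by push_cast; ring
  rw [hc] at h1 h2
  refine (measureReal_mono (fun x hx => ?_)).trans
    ((measureReal_union_le _ _).trans ((add_le_add h1 h2).trans_eq (two_mul _).symm))
  exact (le_abs.1 (show s ≤ |_| from hx)).imp id id

end GaussianConcentration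

section GaussianMaximum

open MeasureTheory ProbabilityTheory Real

variable {X : Type*} [NormedAddCommGroup X] [NormedSpace ℝ X] {m : ℕ}

lemma exp_neg_sq_div_le_measureReal_gaussianReal_Ioc {t : ℝ} (ht : 0 ≤ t) :
    exp (-(t + 1) ^ 2 / 2) / 3 ≤ (gaussianReal 0 1).real (Set.Ioc t (t + 1)) := by
  rw [Measure.real, gaussianReal_apply_eq_integral _ one_ne_zero, ENNReal.toReal_ofReal
    (integral_nonneg fun x => gaussianPDFReal_nonneg _ _ _)]
  have hsqrt : √(2 * π) ≤ 3 := by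
    rw [sqrt_le_left (by norm_num)]; linarith [pi_lt_d2]
  have hconst : ∫ _ in Set.Ioc t (t + 1), exp (-(t + 1) ^ 2 / 2) / 3 =
      exp (-(t + 1) ^ 2 / 2) / 3 := by simp
  rw [← hconst]
  refine setIntegral_mono_on (by simp) (integrable_gaussianPDFReal 0 1).integrableOn
    measurableSet_Ioc fun x hx => ?_
  simp only [gaussianPDFReal, NNReal.coe_one, mul_one, sub_zero]
  rw [div_eq_inv_mul]
  gcongr
  · linarith [hx.1]
  · exact hx.2

lemma measureReal_stdGaussian_forall_abs_le {t : ℝ} (ht : 0 ≤ t) :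
    (stdGaussian (EuclideanSpace ℝ (Fin m))).real {z | ∀ i, |z i| ≤ t} ≤
      exp (-(m * (exp (-(t + 1) ^ 2 / 2) / 3))) := by
  set p := exp (-(t + 1) ^ 2 / 2) / 3
  have hmeas : MeasurableSet {z : EuclideanSpace ℝ (Fin m) | ∀ i, |z i| ≤ t} := by
    rw [Set.ofPred_forall]
    exact MeasurableSet.iInter fun i => measurableSet_le (by fun_prop) measurable_const
  have hone : (gaussianReal 0 1).real {x | |x| ≤ t} ≤ exp (-p) := by
    have hsub : {x : ℝ | |x| ≤ t} ⊆ (Set.Ioc t (t + 1))ᶜ := fun x hx hx' =>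
      absurd hx'.1 (not_lt.2 ((le_abs_self x).trans hx))
    have h1 := measureReal_mono (μ := gaussianReal 0 1) hsub
    rw [probReal_compl_eq_one_sub measurableSet_Ioc] at h1
    have h2 : p ≤ (gaussianReal 0 1).real (Set.Ioc t (t + 1)) :=
      exp_neg_sq_div_le_measureReal_gaussianReal_Ioc ht
    linarith [add_one_le_exp (-p)]
  have hpre : WithLp.toLp 2 ⁻¹' {z : EuclideanSpace ℝ (Fin m) | ∀ i, |z i| ≤ t} =
      Set.univ.pi fun _ => {x : ℝ | |x| ≤ t} := by
    ext x; simp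
  rw [← map_pi_eq_stdGaussian, map_measureReal_apply (by fun_prop) hmeas, hpre, Measure.real,
    Measure.pi_pi, ENNReal.toReal_prod, ← Measure.real, Finset.prod_const, Finset.card_univ,
    Fintype.card_fin]
  calc _ ≤ exp (-p) ^ m := by gcongr
    _ = _ := by rw [← exp_nat_mul]; ring_nf

/-- Reflecting all coordinates other than the `i`-th shows that a large `i`-th coordinate
makes `T z` large on average. -/
lemma mul_measureReal_le_setIntegral_norm_of_reflection (T : EuclideanSpace ℝ (Fin m) →L[ℝ] X)
    {i : Fin m} (hT : 1 / 2 ≤ ‖T (EuclideanSpace.single i 1)‖) {t : ℝ}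
    {A : Set (EuclideanSpace ℝ (Fin m))} (hA : MeasurableSet A) (hAt : ∀ z ∈ A, t ≤ |z i|)
    (hAr : ∀ z w : EuclideanSpace ℝ (Fin m), (∀ j, |z j| = |w j|) → z ∈ A → w ∈ A) :
    t / 2 * (stdGaussian (EuclideanSpace ℝ (Fin m))).real A ≤
      ∫ z in A, ‖T z‖ ∂(stdGaussian (EuclideanSpace ℝ (Fin m))) := by
  set γ := stdGaussian (EuclideanSpace ℝ (Fin m))
  set e : EuclideanSpace ℝ (Fin m) := EuclideanSpace.single i 1 with he
  let R := (ℝ ∙ e).reflection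
  have hR : ∀ z, R z = (2 * z i) • e - z := by
    intro z
    simp only [R, Submodule.reflection_singleton_apply]
    simp [he, EuclideanSpace.inner_single_left, mul_smul, two_smul]
  have hRabs : ∀ z j, |R z j| = |z j| := by
    intro z j
    rw [hR]
    by_cases hj : j = i
    · subst hj
      simp [he, two_mul]
    · simp [he, hj]
  have hpre : R ⁻¹' A = A := by
    ext z
    exact ⟨hAr _ _ (hRabs z), hAr _ _ fun j => (hRabs z j).symm⟩
  have hmp : MeasurePreserving R γ γ := ⟨R.continuous.measurable, stdGaussian_map R⟩
  have hemb : MeasurableEmbedding R := R.toHomeomorph.measurableEmbedding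
  have hswap : ∫ z in A, ‖T (R z)‖ ∂γ = ∫ z in A, ‖T z‖ ∂γ := by
    conv_lhs => rw [← hpre]
    exact hmp.setIntegral_preimage_emb hemb (fun z => ‖T z‖) A
  have hint := integrable_norm_apply_stdGaussian T
  have hint' : Integrable (fun z => ‖T (R z)‖) γ :=
    (hmp.integrable_comp_emb hemb (g := fun z => ‖T z‖)).2 hint
  have hsum : ∫ _ in A, t ∂γ ≤ ∫ z in A, (‖T z‖ + ‖T (R z)‖) ∂γ := by
    refine setIntegral_mono_on (integrable_const t).integrableOn
      (hint.add hint').integrableOn hA fun z hz => ?_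
    calc t ≤ |z i| := hAt z hz
      _ = 2 * |z i| * (1 / 2) := by ring
      _ ≤ 2 * |z i| * ‖T e‖ := by gcongr
      _ = ‖T z + T (R z)‖ := by
        rw [← map_add, hR, add_sub_cancel, map_smul, norm_smul, norm_mul, norm_eq_abs, norm_eq_abs,
          abs_two]
      _ ≤ _ := norm_add_le _ _
  rw [integral_add hint.integrableOn hint'.integrableOn, hswap, setIntegral_const, smul_eq_mul]
    at hsum
  linarith

lemma mul_measureReal_exists_lt_abs_le_integral_norm (T : EuclideanSpace ℝ (Fin m) →L[ℝ] X)
    (hT : ∀ i, 1 / 2 ≤ ‖T (EuclideanSpace.single i 1)‖) (t : ℝ) :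
    t / 2 * (stdGaussian (EuclideanSpace ℝ (Fin m))).real {z | ∃ i, t < |z i|} ≤
      ∫ z, ‖T z‖ ∂(stdGaussian (EuclideanSpace ℝ (Fin m))) := by
  set γ := stdGaussian (EuclideanSpace ℝ (Fin m))
  let A : Fin m → Set (EuclideanSpace ℝ (Fin m)) := fun i => {z | t < |z i| ∧ ∀ j < i, |z j| ≤ t}
  have hA : ∀ i, MeasurableSet (A i) := by
    intro i
    have hlt : MeasurableSet {z : EuclideanSpace ℝ (Fin m) | t < |z i|} :=
      measurableSet_lt measurable_const (by fun_prop)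
    have hle : MeasurableSet {z : EuclideanSpace ℝ (Fin m) | ∀ j < i, |z j| ≤ t} := by
      simp only [Set.ofPred_forall]
      exact MeasurableSet.iInter fun j => MeasurableSet.iInter fun _ =>
        measurableSet_le (by fun_prop) measurable_const
    exact hlt.inter hle
  have hdisj : Pairwise (Function.onFun Disjoint A) := by
    intro i j hij
    refine Set.disjoint_left.2 fun z hi hj => ?_
    rcases lt_or_gt_of_ne hij with h | h
    · exact absurd hi.1 (not_lt.2 (hj.2 i h))
    · exact absurd hj.1 (not_lt.2 (hi.2 j h))
  have hunion : {z : EuclideanSpace ℝ (Fin m) | ∃ i, t < |z i|} = ⋃ i, A i := by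
    ext z
    simp only [Set.mem_ofPred_eq, Set.mem_iUnion, A]
    refine ⟨fun h => ?_, fun ⟨i, hi, _⟩ => ⟨i, hi⟩⟩
    obtain ⟨i, hi, hmin⟩ := WellFounded.has_min (wellFounded_lt (α := Fin m)) {i | t < |z i|} h
    exact ⟨i, hi, fun j hj => not_lt.1 fun hlt => hmin j hlt hj⟩
  have hint := integrable_norm_apply_stdGaussian T
  calc t / 2 * γ.real {z | ∃ i, t < |z i|} = ∑ i, t / 2 * γ.real (A i) := by
        rw [hunion, measureReal_iUnion_fintype hdisj hA, Finset.mul_sum]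
    _ ≤ ∑ i, ∫ z in A i, ‖T z‖ ∂γ := by
        refine Finset.sum_le_sum fun i _ => ?_
        refine mul_measureReal_le_setIntegral_norm_of_reflection T (hT i) (hA i)
          (fun z hz => hz.1.le) fun z w hzw hz => ?_
        simpa only [A, Set.mem_ofPred_eq, hzw] using hz
    _ = ∫ z in ⋃ i, A i, ‖T z‖ ∂γ :=
        (integral_iUnion_fintype hA hdisj fun i => hint.integrableOn).symm
    _ ≤ ∫ z, ‖T z‖ ∂γ := setIntegral_le_integral hint (.of_forall fun z => norm_nonneg _)

/-- The Gaussian average of the norm grows like `√(log m)`. -/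
theorem sqrt_log_le_integral_norm_stdGaussian (T : EuclideanSpace ℝ (Fin m) →L[ℝ] X)
    (hT : ∀ i, 1 / 2 ≤ ‖T (EuclideanSpace.single i 1)‖) (hm : 4 ≤ log m) :
    √(log m) / 8 ≤ ∫ z, ‖T z‖ ∂(stdGaussian (EuclideanSpace ℝ (Fin m))) := by
  set γ := stdGaussian (EuclideanSpace ℝ (Fin m))
  have hm0 : (0 : ℝ) < m := by
    rcases Nat.eq_zero_or_pos m with h | h
    · subst h; norm_num at hm
    · exact_mod_cast h
  have hs : 2 ≤ √(log m) := le_sqrt_of_sq_le (by linarith)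
  set t := √(log m) - 1 with ht
  have hpow : (t + 1) ^ 2 = log m := by rw [ht, sub_add_cancel, sq_sqrt (by linarith)]
  have hlarge : 1 ≤ m * (exp (-(t + 1) ^ 2 / 2) / 3) := by
    have h1 : (m : ℝ) * exp (-(t + 1) ^ 2 / 2) = exp (log m / 2) := by
      nth_rewrite 1 [← exp_log hm0]
      rw [← exp_add, hpow]
      ring_nf
    have h2 : (3 : ℝ) ≤ exp (log m / 2) := by linarith [add_one_le_exp (log m / 2)]
    rw [← mul_div_assoc, h1]
    linarith
  have hhalf : γ.real {z | ∀ i, |z i| ≤ t} ≤ 1 / 2 := by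
    refine (measureReal_stdGaussian_forall_abs_le (by linarith)).trans ?_
    refine (exp_le_exp.2 (neg_le_neg hlarge)).trans ?_
    linarith [exp_neg_one_lt_d9]
  have hcompl : γ.real {z | ∃ i, t < |z i|} = 1 - γ.real {z | ∀ i, |z i| ≤ t} := by
    rw [← probReal_compl_eq_one_sub]
    · congr 1; ext z; simp
    · rw [Set.ofPred_forall]
      exact MeasurableSet.iInter fun i => measurableSet_le (by fun_prop) measurable_const
  refine le_trans ?_ (mul_measureReal_exists_lt_abs_le_integral_norm T hT t)
  have : 1 / 2 ≤ γ.real {z | ∃ i, t < |z i|} := by rw [hcompl]; linarith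
  calc √(log m) / 8 ≤ t / 2 * (1 / 2) := by rw [ht]; linarith
    _ ≤ _ := by
      refine mul_le_mul_of_nonneg_left this ?_
      linarith

end GaussianMaximum

section RandomEmbedding

open MeasureTheory ProbabilityTheory Real

variable {F : Type*} [NormedAddCommGroup F] [InnerProductSpace ℝ F]
  {X : Type*} [NormedAddCommGroup X] [NormedSpace ℝ X] {k : ℕ}

/-- The map `(z₁, …, z_k) ↦ ∑ a_l z_l`. -/
noncomputable def weightedSum (F : Type*) [NormedAddCommGroup F] [InnerProductSpace ℝ F]
    (a : Fin k → ℝ) : PiLp 2 (fun _ : Fin k => F) →L[ℝ] F :=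
  ∑ l, a l • PiLp.proj 2 (fun _ : Fin k => F) l

lemma weightedSum_apply (a : Fin k → ℝ) (z : PiLp 2 (fun _ : Fin k => F)) :
    weightedSum F a z = ∑ l, a l • z l := by
  simp [weightedSum]

lemma norm_weightedSum_apply_le (a : Fin k → ℝ) (z : PiLp 2 (fun _ : Fin k => F)) :
    ‖weightedSum F a z‖ ≤ √(∑ l, a l ^ 2) * ‖z‖ := by
  rw [weightedSum_apply, PiLp.norm_eq_of_L2]
  calc ‖∑ l, a l • z l‖ ≤ ∑ l, |a l| * ‖z l‖ :=
        (norm_sum_le _ _).trans_eq (by simp [norm_smul])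
    _ ≤ √(∑ l, |a l| ^ 2) * √(∑ l, ‖z l‖ ^ 2) := sum_mul_le_sqrt_mul_sqrt _ _ _
    _ = _ := by simp only [sq_abs]

lemma norm_comp_weightedSum (a : Fin k → ℝ) (L : StrongDual ℝ F) :
    ‖L ∘L weightedSum F a‖ = √(∑ l, a l ^ 2) * ‖L‖ := by
  set r := √(∑ l, a l ^ 2) with hr
  have hr0 : 0 ≤ r := sqrt_nonneg _
  have hr2 : r ^ 2 = ∑ l, a l ^ 2 := sq_sqrt (Finset.sum_nonneg fun _ _ => sq_nonneg _)
  refine le_antisymm ?_ ?_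
  · refine ContinuousLinearMap.opNorm_le_bound _ (by positivity) fun z => ?_
    calc ‖L (weightedSum F a z)‖ ≤ ‖L‖ * ‖weightedSum F a z‖ := L.le_opNorm _
      _ ≤ ‖L‖ * (r * ‖z‖) := by gcongr; exact norm_weightedSum_apply_le a z
      _ = r * ‖L‖ * ‖z‖ := by ring
  · rcases hr0.eq_or_lt with h0 | hpos
    · rw [← h0, zero_mul]; positivity
    rw [mul_comm, ← le_div_iff₀ hpos]
    refine ContinuousLinearMap.opNorm_le_bound _ (by positivity) fun f => ?_
    let z : PiLp 2 (fun _ : Fin k => F) := WithLp.toLp 2 fun l => a l • f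
    have hz : ‖z‖ = r * ‖f‖ := by
      rw [PiLp.norm_eq_of_L2]
      simp only [z, norm_smul, mul_pow, norm_eq_abs, sq_abs]
      rw [← Finset.sum_mul, ← hr2, ← mul_pow, sqrt_sq (by positivity)]
    have hLz : (L ∘L weightedSum F a) z = r ^ 2 * L f := by
      simp [weightedSum_apply, z, smul_smul, ← pow_two, ← Finset.sum_mul, hr2]
    have := (L ∘L weightedSum F a).le_opNorm z
    rw [hLz, hz, norm_mul, norm_of_nonneg (by positivity)] at this
    rw [div_mul_eq_mul_div, le_div_iff₀ hpos]
    refine le_of_mul_le_mul_left ?_ hpos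
    linarith

variable [FiniteDimensional ℝ F] [MeasurableSpace F] [BorelSpace F]

lemma map_weightedSum_stdGaussian (a : Fin k → ℝ) :
    (stdGaussian (PiLp 2 (fun _ : Fin k => F))).map (weightedSum F a) =
      (stdGaussian F).map (√(∑ l, a l ^ 2) • ContinuousLinearMap.id ℝ F) := by
  have := Measure.isProbabilityMeasure_map (μ := stdGaussian (PiLp 2 (fun _ : Fin k => F)))
    (weightedSum F a).continuous.aemeasurable
  have := Measure.isProbabilityMeasure_map (μ := stdGaussian F)
    (√(∑ l, a l ^ 2) • ContinuousLinearMap.id ℝ F).continuous.aemeasurable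
  refine Measure.ext_of_charFunDual (funext fun L => ?_)
  rw [charFunDual_map, charFunDual_map, charFunDual_stdGaussian, charFunDual_stdGaussian,
    norm_comp_weightedSum, ContinuousLinearMap.comp_smul, norm_smul, norm_of_nonneg (sqrt_nonneg _),
    ContinuousLinearMap.comp_id]

lemma integral_norm_weightedSum_stdGaussian (T : F →L[ℝ] X) (a : Fin k → ℝ) :
    ∫ z, ‖(T ∘L weightedSum F a) z‖ ∂(stdGaussian (PiLp 2 (fun _ : Fin k => F))) =
      √(∑ l, a l ^ 2) * ∫ z, ‖T z‖ ∂(stdGaussian F) := by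
  have h := integral_map (μ := stdGaussian (PiLp 2 (fun _ : Fin k => F))) (φ := weightedSum F a)
    (weightedSum F a).continuous.aemeasurable (f := fun z => ‖T z‖) (by fun_prop)
  simp only [ContinuousLinearMap.comp_apply]
  rw [← h, map_weightedSum_stdGaussian, integral_map
    (ContinuousLinearMap.continuous _).aemeasurable (by fun_prop), ← integral_const_mul]
  simp [norm_smul, abs_of_nonneg (sqrt_nonneg _)]

/-- A random Gaussian embedding of `ℝ^k` is almost isometric on the grid. -/
theorem exists_almostEuclideanOnGrid (T : F →L[ℝ] X) (hT : ‖T‖ ≤ 1) {ρ δ D : ℝ} (hδ : 0 < δ)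
    (hD : D = ∫ z, ‖T z‖ ∂(stdGaussian F)) (hD0 : 0 < D)
    (hk : 5 ^ k * (2 * exp (-(δ * D) ^ 2 / 6)) < 1) :
    ∃ (V : (Fin k → ℝ) →ₗ[ℝ] X) (N : Seminorm ℝ (Fin k → ℝ)), (∀ a, ‖V a‖ = D * N a) ∧
      N.AlmostEuclideanOnGrid ρ δ := by
  classical
  set γ := stdGaussian (PiLp 2 (fun _ : Fin k => F))
  let S : Finset (Fin k → ℝ) := Fintype.piFinset fun _ => {0, 1, -1, ρ, -ρ}
  have hS : S.card ≤ 5 ^ k := by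
    rw [Fintype.card_piFinset_const]
    gcongr
    exact Finset.card_le_five
  let r : (Fin k → ℝ) → ℝ := fun a => √(∑ l, a l ^ 2)
  let B : (Fin k → ℝ) → Set (PiLp 2 (fun _ : Fin k => F)) := fun a =>
    {z | δ * D * r a < |‖T (weightedSum F a z)‖ - r a * D|}
  have hB : ∀ a, γ.real (B a) ≤ 2 * exp (-(δ * D) ^ 2 / 6) := by
    intro a
    have hr0 : 0 ≤ r a := sqrt_nonneg _
    have hW : ‖T ∘L weightedSum F a‖ ≤ r a := by
      refine ContinuousLinearMap.opNorm_le_bound _ hr0 fun z => ?_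
      calc ‖T (weightedSum F a z)‖ ≤ ‖T‖ * ‖weightedSum F a z‖ := T.le_opNorm _
        _ ≤ 1 * (r a * ‖z‖) := by gcongr; exact norm_weightedSum_apply_le a z
        _ = r a * ‖z‖ := one_mul _
    rcases (norm_nonneg (T ∘L weightedSum F a)).eq_or_lt with h0 | hpos
    · have hz : ∀ z, T (weightedSum F a z) = 0 := fun z =>
        norm_le_zero_iff.1 (by simpa [← h0] using (T ∘L weightedSum F a).le_opNorm z)
      have hrD : r a * D = 0 := by
        rw [hD, ← integral_norm_weightedSum_stdGaussian]
        simp [hz]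
      have : B a = ∅ := by
        ext z
        simp [B, hz, (mul_eq_zero.1 hrD).resolve_right hD0.ne']
      rw [this, measureReal_empty]
      positivity
    have hc := measureReal_abs_norm_sub_integral_ge_le (T ∘L weightedSum F a)
      (s := δ * D * r a) (by positivity)
    rw [integral_norm_weightedSum_stdGaussian, ← hD] at hc
    refine (measureReal_mono fun z hz => ?_).trans (hc.trans ?_)
    · exact (show δ * D * r a < _ from hz).le
    · gcongr 2 * exp ?_
      rw [neg_div, neg_div, neg_le_neg_iff, mul_pow _ (r a), div_le_div_iff₀ (by norm_num)
        (by positivity)]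
      have : ‖T ∘L weightedSum F a‖ ^ 2 ≤ r a ^ 2 := by gcongr
      nlinarith [sq_nonneg (δ * D)]
  have hbad : γ.real (⋃ a ∈ S, B a) < 1 := by
    refine (measureReal_biUnion_finset_le _ _).trans_lt ?_
    refine (Finset.sum_le_sum fun a _ => hB a).trans_lt ?_
    rw [Finset.sum_const, nsmul_eq_mul]
    refine lt_of_le_of_lt ?_ hk
    gcongr
    exact_mod_cast hS
  obtain ⟨G, hG⟩ : ∃ G, G ∉ ⋃ a ∈ S, B a := by
    by_contra! h
    rw [Set.eq_univ_of_forall h, probReal_univ] at hbad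
    exact lt_irrefl _ hbad
  let V : (Fin k → ℝ) →ₗ[ℝ] X := T.toLinearMap ∘ₗ Fintype.linearCombination ℝ G.ofLp
  have hV : ∀ a, V a = T (weightedSum F a G) := by
    intro a
    simp [V, weightedSum_apply, Fintype.linearCombination_apply]
  refine ⟨V, D.toNNReal⁻¹ • (normSeminorm ℝ X).comp V, fun a => ?_, fun a ha => ?_⟩
  · simp [NNReal.smul_def, hD0.le, hD0.ne']
  · have haS : a ∈ S := by
      simpa [S, Fintype.mem_piFinset] using ha
    have hGa : |‖V a‖ - r a * D| ≤ δ * D * r a := by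
      rw [hV]
      exact not_lt.1 fun h => hG (Set.mem_biUnion haS h)
    have hN : (D.toNNReal⁻¹ • (normSeminorm ℝ X).comp V) a = ‖V a‖ / D := by
      simp [NNReal.smul_def, hD0.le, div_eq_inv_mul]
    rw [hN]
    have : ‖V a‖ / D - r a = (‖V a‖ - r a * D) / D := by field_simp
    change |‖V a‖ / D - r a| ≤ δ * r a
    rw [this, abs_div, abs_of_pos hD0, div_le_iff₀ hD0]
    linarith

end RandomEmbedding

section LargeDimension

open MeasureTheory ProbabilityTheory Real

lemma five_pow_mul_exp_lt_one {k : ℕ} {D : ℝ} {L : ℝ} (hk : 0 < k) (hL : 0 ≤ L) (hD : √L / 8 ≤ D)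
    (hkL : 72000000000000 * (k : ℝ) ^ 3 < L) :
    5 ^ k * (2 * exp (-(1 / (250000 * k) * D) ^ 2 / 6)) < 1 := by
  have hk0 : (0 : ℝ) < k := by exact_mod_cast hk
  have hD2 : L / 64 ≤ D ^ 2 := by
    calc L / 64 = (√L / 8) ^ 2 := by rw [div_pow, sq_sqrt hL]; norm_num
      _ ≤ D ^ 2 := by gcongr
  have hexp : 3 * (k : ℝ) < (1 / (250000 * k) * D) ^ 2 / 6 := by
    have h : (1 / (250000 * (k : ℝ)) * D) ^ 2 / 6 = D ^ 2 / (375000000000 * k ^ 2) := by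
      field_simp; ring
    rw [h, lt_div_iff₀ (by positivity)]
    linarith
  have h10 : (5 : ℝ) ^ k * 2 ≤ exp (3 * k) := by
    have h5 : (10 : ℝ) ≤ exp 3 := by
      have h1 : exp 3 = exp 1 ^ 3 := by rw [← exp_nat_mul]; norm_num
      have h2 : (2.7 : ℝ) ^ 3 ≤ exp 1 ^ 3 := by
        gcongr
        linarith [exp_one_gt_d9]
      rw [h1]
      linarith
    calc (5 : ℝ) ^ k * 2 ≤ 5 ^ k * 2 ^ k := by
          gcongr
          exact le_self_pow₀ (by norm_num) hk.ne'
      _ = 10 ^ k := by rw [← mul_pow]; norm_num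
      _ ≤ exp 3 ^ k := by gcongr
      _ = exp (3 * k) := by rw [← exp_nat_mul]; ring_nf
  rw [← mul_assoc]
  calc (5 : ℝ) ^ k * 2 * exp (-(1 / (250000 * k) * D) ^ 2 / 6)
      ≤ exp (3 * k) * exp (-(1 / (250000 * k) * D) ^ 2 / 6) := by gcongr
    _ = exp (3 * k + -(1 / (250000 * k) * D) ^ 2 / 6) := (exp_add _ _).symm
    _ < 1 := by
      rw [exp_lt_one_iff, neg_div]
      linarith

/-- A normed space of large dimension contains an equilateral set of `k` points as soon as `k ^ 3`
is small compared with the logarithm of the dimension. -/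
theorem exists_isEquilateral_card_eq {X : Type*} [NormedAddCommGroup X] [NormedSpace ℝ X]
    [FiniteDimensional ℝ X] {k : ℕ} (hk : 0 < k)
    (hX : 1000000000000000 * (k : ℝ) ^ 3 ≤ log (Module.finrank ℝ X)) :
    ∃ S : Finset X, IsEquilateral (S : Set X) ∧ S.card = k := by
  classical
  have hk1 : (1 : ℝ) ≤ k := by exact_mod_cast hk
  have hk3 : (1 : ℝ) ≤ (k : ℝ) ^ 3 := one_le_pow₀ hk1
  obtain ⟨m, hm, T₀, hT₀, hT₀e⟩ := exists_contraction_half_le_norm_single (X := X)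
  let T := T₀.toContinuousLinearMap
  have hT : ‖T‖ ≤ 1 := T.opNorm_le_bound zero_le_one fun z => by simpa [T] using hT₀ z
  have hTe : ∀ i, 1 / 2 ≤ ‖T (EuclideanSpace.single i 1)‖ := hT₀e
  have hfin : 0 < Module.finrank ℝ X := by
    rcases Nat.eq_zero_or_pos (Module.finrank ℝ X) with h | h
    · rw [h, Nat.cast_zero, log_zero] at hX
      linarith
    · exact h
  have hlog : log (Module.finrank ℝ X) ≤ 1 + log m := by
    have hm0 : (0 : ℝ) < m := by exact_mod_cast (by omega : 0 < m)
    calc log (Module.finrank ℝ X) ≤ log (2 * m) :=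
          log_le_log (by exact_mod_cast hfin) (by exact_mod_cast hm)
      _ = log 2 + log m := log_mul two_ne_zero hm0.ne'
      _ ≤ 1 + log m := by linarith [log_two_lt_d9]
  have hm4 : 4 ≤ log m := by linarith
  set D := ∫ z, ‖T z‖ ∂(stdGaussian (EuclideanSpace ℝ (Fin m))) with hD
  have hDle : √(log m) / 8 ≤ D := sqrt_log_le_integral_norm_stdGaussian T hTe hm4
  have hD0 : 0 < D := lt_of_lt_of_le (by positivity) hDle
  set β : ℝ := 1 / (10000 * k) with hβ
  obtain ⟨V, N, hVN, hN⟩ := exists_almostEuclideanOnGrid T hT (k := k) (ρ := 200 * β)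
    (δ := 1 / (250000 * k)) (by positivity) hD hD0
    (five_pow_mul_exp_lt_one hk (by linarith) hDle (by linarith))
  have hδ : 1 / (250000 * (k : ℝ)) = β / 25 := by rw [hβ]; field_simp; norm_num
  rw [hδ] at hN
  obtain ⟨p, hp⟩ := hN.exists_equilateral (by positivity)
    (one_div_le_one_div_of_le (by norm_num) (by linarith)) (by field_simp; norm_num)
  have hdist : ∀ i j, i ≠ j → ‖V (p i) - V (p j)‖ = D * √2 := by
    intro i j hij
    rw [← map_sub, hVN, hp i j hij]
  have hpos : 0 < D * √2 := by positivity
  have hinj : Function.Injective fun i => V (p i) := by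
    intro i j hij
    by_contra hne
    have := hdist i j hne
    rw [show V (p i) = V (p j) from hij, sub_self, norm_zero] at this
    exact hpos.ne this
  refine ⟨Finset.univ.image fun i => V (p i), ⟨D * √2, hpos, ?_⟩, ?_⟩
  · intro x hx y hy hxy
    simp only [Finset.coe_image, Finset.coe_univ, Set.image_univ, Set.mem_range] at hx hy
    obtain ⟨i, rfl⟩ := hx
    obtain ⟨j, rfl⟩ := hy
    exact hdist i j fun h => hxy (by rw [h])
  · rw [Finset.card_image_of_injective _ hinj, Finset.card_univ, Fintype.card_fin]

end LargeDimension

/-- There is an absolute constant `c > 0` such that every `n`-dimensional real normed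
space (`n ≥ 2`) contains an equilateral set of at least `c (log n)^{1/3}` points,
i.e. its equilateral number is at least `c (log n)^{1/3}`. -/
theorem equilateral_number_ge_log_cbrt :
    ∃ c : ℝ, 0 < c ∧
      ∀ (X : Type*) [NormedAddCommGroup X] [NormedSpace ℝ X] [FiniteDimensional ℝ X]
        (n : ℕ), 2 ≤ n → Module.finrank ℝ X = n →
        ∃ S : Finset X, IsEquilateral (S : Set X) ∧
          c * Real.log n ^ ((1 : ℝ) / 3) ≤ (S.card : ℝ) := by
  refine ⟨1 / 200000, by norm_num, fun X _ _ _ n hn hX => ?_⟩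
  have hlog : 0 ≤ Real.log n := Real.log_natCast_nonneg n
  set x := Real.log n ^ ((1 : ℝ) / 3) with hx
  have hx0 : 0 ≤ x := Real.rpow_nonneg hlog _
  have hx3 : x ^ 3 = Real.log n := by
    rw [hx, ← Real.rpow_natCast, ← Real.rpow_mul hlog]
    norm_num
  rcases Nat.eq_zero_or_pos ⌊x / 100000⌋₊ with h0 | hpos
  · refine ⟨{0}, ⟨1, one_pos, fun y hy z hz hyz => absurd ?_ hyz⟩, ?_⟩
    · simp only [Finset.coe_singleton, Set.mem_singleton_iff] at hy hz
      rw [hy, hz]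
    · have := Nat.floor_eq_zero.1 h0
      simp only [Finset.card_singleton, Nat.cast_one]
      linarith
  · have hle : (⌊x / 100000⌋₊ : ℝ) ≤ x / 100000 := Nat.floor_le (by positivity)
    have hlt : x / 100000 < ⌊x / 100000⌋₊ + 1 := Nat.lt_floor_add_one _
    have h1 : (1 : ℝ) ≤ ⌊x / 100000⌋₊ := by exact_mod_cast hpos
    obtain ⟨S, hS, hcard⟩ := exists_isEquilateral_card_eq (X := X) hpos (by
      rw [hX, ← hx3]
      calc 1000000000000000 * (⌊x / 100000⌋₊ : ℝ) ^ 3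
          ≤ 1000000000000000 * (x / 100000) ^ 3 := by gcongr
        _ = x ^ 3 := by ring)
    refine ⟨S, hS, ?_⟩
    rw [hcard]
    linarith
end

section
/- Let X be a finite-dimensional real normed space containing a k-dimensional linear subspace Y (with the induced norm) whose Banach–Mazur distance to ℓ∞^k satisfies d(Y, ℓ∞^k) ≤ 3/2. Then e(X) ≥ k + 1. -/
/-- The Banach–Mazur distance `d(X, Y) = inf ‖T‖ ‖T⁻¹‖`, the infimum taken over all
(continuous) linear isomorphisms `T : X → Y`. -/
noncomputable def BMdist (X Y : Type*) [NormedAddCommGroup X] [NormedSpace ℝ X]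
    [NormedAddCommGroup Y] [NormedSpace ℝ Y] : ℝ :=
  sInf {r : ℝ | ∃ T : X ≃L[ℝ] Y, r = ‖(T : X →L[ℝ] Y)‖ * ‖(T.symm : Y →L[ℝ] X)‖}

open MeasureTheory Metric Set Polynomial

lemma exists_det_one_add_eq_sum (E : Type*) [NormedAddCommGroup E] [NormedSpace ℝ E]
    [FiniteDimensional ℝ E] {s : Finset ℝ} (hs : Module.finrank ℝ E < s.card) :
    ∃ w : ℝ → ℝ, ∀ A : E →L[ℝ] E, (1 + A).det = ∑ t ∈ s, w t * (1 + t • A).det := by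
  classical
  refine ⟨fun t => (Lagrange.basis s id t).eval 1, fun A => ?_⟩
  let b := Module.finBasis ℝ E
  let M := LinearMap.toMatrix b b (A : E →ₗ[ℝ] E)
  let p : ℝ[X] := Matrix.det ((X : ℝ[X]) • M.map C + (1 : Matrix _ _ ℝ).map C)
  have hp : ∀ t : ℝ, (1 + t • A).det = p.eval t := by
    intro t
    have h1 : p.eval t = (t • M + 1).det := by
      rw [← coe_evalRingHom, RingHom.map_det]
      congr 1
      ext i j
      by_cases h : i = j <;> simp [h, mul_comm t]
    rw [h1, ContinuousLinearMap.det, ← LinearMap.det_toMatrix b, add_comm]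
    congr 1
    simp [M, LinearMap.toMatrix_one]
  have hdeg : p.degree < s.card := by
    have := Polynomial.natDegree_det_X_add_C_le M 1
    rw [Fintype.card_fin] at this
    exact degree_le_natDegree.trans_lt (by exact_mod_cast this.trans_lt hs)
  have h := congrArg (eval 1) (Lagrange.eq_interpolate (Function.injective_id.injOn) hdeg)
  have h1 := hp 1
  rw [one_smul] at h1
  rw [h1, h, Lagrange.interpolate_apply, eval_finsetSum]
  refine Finset.sum_congr rfl fun t _ => ?_
  rw [hp t, eval_mul, eval_C, mul_comm]
  rfl

lemma exists_det_one_add_pos (E : Type*) [NormedAddCommGroup E] [NormedSpace ℝ E]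
    [FiniteDimensional ℝ E] :
    ∃ δ > 0, ∀ A : E →L[ℝ] E, ‖A‖ < δ → 0 < (1 + A).det := by
  have hc : Continuous fun A : E →L[ℝ] E => (1 + A).det :=
    ContinuousLinearMap.continuous_det.comp (continuous_const.add continuous_id)
  have h0 : (0 : ℝ) < ((1 : E →L[ℝ] E) + 0).det := by
    rw [add_zero, ContinuousLinearMap.det]
    simp
  obtain ⟨δ, hδ, h⟩ := Metric.eventually_nhds_iff.1 (hc.continuousAt.eventually (lt_mem_nhds h0))
  exact ⟨δ, hδ, fun A hA => h (by simpa using hA)⟩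

section
variable {E : Type*} [NormedAddCommGroup E] [NormedSpace ℝ E] [FiniteDimensional ℝ E]

lemma bijective_add_of_lipschitz {g : E → E} {L : NNReal} (hg : LipschitzWith L g) (hL : L < 1) :
    Function.Bijective fun x => x + g x := by
  have hA : ApproximatesLinearOn (fun x => x + g x)
      ((ContinuousLinearEquiv.refl ℝ E : E ≃L[ℝ] E) : E →L[ℝ] E) univ L := by
    intro x _ y _
    have : x + g x - (y + g y) - (x - y) = g x - g y := by abel
    simpa [this] using hg.norm_sub_le x y
  have hc : Subsingleton E ∨
      L < ‖((ContinuousLinearEquiv.refl ℝ E : E ≃L[ℝ] E).symm : E →L[ℝ] E)‖₊⁻¹ := by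
    rcases subsingleton_or_nontrivial E with h | h
    · exact Or.inl h
    · right
      have : ‖((ContinuousLinearEquiv.refl ℝ E : E ≃L[ℝ] E).symm : E →L[ℝ] E)‖₊ = 1 := by
        apply NNReal.eq
        exact ContinuousLinearMap.norm_id
      rwa [this, inv_one]
  exact ⟨fun x y h => hA.injOn hc (mem_univ _) (mem_univ _) h, hA.surjective hc⟩

lemma image_eq_of_bijective_of_eqOn_compl {α : Type*} {f : α → α} {s : Set α}
    (hf : Function.Bijective f) (h : EqOn f id sᶜ) : f '' s = s := by
  rw [← compl_inj_iff, ← image_compl_eq hf, h.image_eq, image_id]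

lemma integral_det_one_add_of_small [MeasurableSpace E] [BorelSpace E] (μ : Measure E)
    [μ.IsAddHaarMeasure] {g : E → E} {g' : E → E →L[ℝ] E} {s : Set E} {L : NNReal}
    (hs : IsOpen s)
    (hg : LipschitzWith L g) (hL : L < 1) (hzero : ∀ x ∉ s, g x = 0)
    (hg' : ∀ x ∈ s, HasFDerivAt g (g' x) x) (hpos : ∀ x ∈ s, 0 < (1 + g' x).det) :
    ∫ x in s, (1 + g' x).det ∂μ = μ.real s := by
  have hb := bijective_add_of_lipschitz hg hL
  have him : (fun x => x + g x) '' s = s :=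
    image_eq_of_bijective_of_eqOn_compl hb fun x hx => by simp [hzero x hx]
  have h := integral_image_eq_integral_abs_det_fderiv_smul μ hs.measurableSet
    (f := fun x => x + g x) (f' := fun x => 1 + g' x)
    (fun x hx => ((hasFDerivAt_id x).add (hg' x hx)).hasFDerivWithinAt) hb.1.injOn
    (fun _ => (1 : ℝ))
  rw [him] at h
  simp only [smul_eq_mul, mul_one, integral_const, measureReal_restrict_apply_univ] at h
  rw [h]
  exact setIntegral_congr_fun hs.measurableSet fun x hx => (abs_of_pos (hpos x hx)).symm

lemma integral_det_one_add_fderiv [MeasurableSpace E] [BorelSpace E] (μ : Measure E)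
    [μ.IsAddHaarMeasure] {g : E → E} {g' : E → E →L[ℝ] E} {s : Set E} {L : NNReal}
    (hs : IsOpen s) (hs0 : μ.real s ≠ 0)
    (hg : LipschitzWith L g) (hzero : ∀ x ∉ s, g x = 0)
    (hg' : ∀ x ∈ s, HasFDerivAt g (g' x) x) :
    ∫ x in s, (1 + g' x).det ∂μ = μ.real s := by
  obtain ⟨δ, hδ, hdet⟩ := exists_det_one_add_pos E
  set c : ℝ := min δ 1 / (L + 1) with hc
  have hc0 : 0 < c := by positivity
  obtain ⟨T, hT, hTcard⟩ := (Ioo_infinite hc0).exists_subset_card_eq (Module.finrank ℝ E + 1)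
  obtain ⟨w, hw⟩ := exists_det_one_add_eq_sum E (s := T) (by omega)
  have hcL : ∀ t ∈ T, t * L < min δ 1 := by
    intro t ht
    have h1 := hT ht
    have h2 : c * (L + 1) = min δ 1 := div_mul_cancel₀ _ (by positivity)
    have := L.coe_nonneg
    nlinarith [h1.1, h1.2]
  have hint : ∀ t ∈ T, ∫ x in s, (1 + t • g' x).det ∂μ = μ.real s := by
    intro t ht
    have ht0 : 0 < t := (hT ht).1
    have hlip : LipschitzWith (⟨t, ht0.le⟩ * L) fun x => t • g x := by
      refine LipschitzWith.of_dist_le_mul fun x y => ?_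
      rw [dist_smul₀, Real.norm_of_nonneg ht0.le]
      change _ ≤ t * L * _
      rw [mul_assoc]
      exact mul_le_mul_of_nonneg_left (hg.dist_le_mul x y) ht0.le
    refine integral_det_one_add_of_small μ hs hlip ?_ (fun x hx => by simp [hzero x hx])
      (fun x hx => (hg' x hx).const_smul t) fun x hx => hdet _ ?_
    · exact (hcL t ht).trans_le (min_le_right _ _)
    · rw [norm_smul, Real.norm_of_nonneg ht0.le]
      refine lt_of_le_of_lt ?_ ((hcL t ht).trans_le (min_le_left _ _))
      exact mul_le_mul_of_nonneg_left ((hg' x hx).le_of_lipschitz hg) ht0.le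
  have hsum : ∑ t ∈ T, w t = 1 := by
    simpa [ContinuousLinearMap.det] using (hw 0).symm
  rw [funext fun x => hw (g' x), integral_finsetSum]
  · simp_rw [integral_const_mul]
    rw [Finset.sum_congr rfl fun t ht => by rw [hint t ht], ← Finset.sum_mul, hsum, one_mul]
  · intro t ht
    refine Integrable.const_mul ?_ _
    by_contra hni
    exact hs0 (by rw [← hint t ht, integral_undef hni])

end

lemma lipschitzWith_of_lipschitzOnWith_closedBall {E F : Type*}
    [NormedAddCommGroup E] [NormedSpace ℝ E] [NormedAddCommGroup F]
    {g : E → F} {L : NNReal} {R : ℝ}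
    (hg : LipschitzOnWith L g (closedBall 0 R)) (hzero : ∀ x ∉ ball (0 : E) R, g x = 0) :
    LipschitzWith L g := by
  have key : ∀ x ∈ ball (0 : E) R, ∀ y ∉ ball (0 : E) R, dist (g x) (g y) ≤ L * dist x y := by
    intro x hx y hy
    have hx' : ‖x‖ < R := by simpa using hx
    have hy' : R ≤ ‖y‖ := by simpa using hy
    obtain ⟨z, hz, hzR⟩ : R ∈ (fun z : E => ‖z‖) '' segment ℝ x y :=
      ((convex_segment x y).isPreconnected.image _ continuous_norm.continuousOn).Icc_subset
        (mem_image_of_mem _ (left_mem_segment ℝ x y))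
        (mem_image_of_mem _ (right_mem_segment ℝ x y)) ⟨hx'.le, hy'⟩
    have hzR : ‖z‖ = R := hzR
    have hgz : g z = g y := by rw [hzero y hy, hzero z (by simp [hzR])]
    have hd := dist_add_dist_of_mem_segment hz
    calc dist (g x) (g y) = dist (g x) (g z) := by rw [hgz]
      _ ≤ L * dist x z := hg.dist_le_mul _ (ball_subset_closedBall hx) _ (by simp [hzR])
      _ ≤ L * dist x y := by
        gcongr
        linarith [dist_nonneg (x := z) (y := y)]
  refine LipschitzWith.of_dist_le_mul fun x y => ?_
  by_cases hx : x ∈ ball (0 : E) R <;> by_cases hy : y ∈ ball (0 : E) R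
  · exact hg.dist_le_mul _ (ball_subset_closedBall hx) _ (ball_subset_closedBall hy)
  · exact key x hx y hy
  · rw [dist_comm, dist_comm x]
    exact key y hy x hx
  · rw [hzero x hx, hzero y hy, dist_self]
    positivity
section
variable {E : Type*} [NormedAddCommGroup E] [InnerProductSpace ℝ E] [FiniteDimensional ℝ E]

lemma det_eq_zero_of_norm_eventually_const {r : E → E} {r' : E →L[ℝ] E} {x : E} {R : ℝ}
    (hr : HasFDerivAt r r' x) (hR : R ≠ 0) (hconst : ∀ᶠ y in nhds x, ‖r y‖ = R) :
    r'.det = 0 := by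
  by_contra hdet
  have hunit : IsUnit (LinearMap.det (r' : E →ₗ[ℝ] E)) := isUnit_iff_ne_zero.2 hdet
  have hsurj : Function.Surjective r' :=
    (LinearMap.isUnit_iff_range_eq_top _).1 ((LinearMap.isUnit_iff_isUnit_det _).2 hunit)
      |> LinearMap.range_eq_top.1
  obtain ⟨v, hv⟩ := hsurj (r x)
  have h1 : HasFDerivAt (fun y => ‖r y‖ ^ 2) (0 : E →L[ℝ] ℝ) x := by
    refine (hasFDerivAt_const (R ^ 2) x).congr_of_eventuallyEq ?_
    filter_upwards [hconst] with y hy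
    rw [hy]
  have h2 := DFunLike.congr_fun (h1.unique hr.norm_sq) v
  have h3 : ‖r x‖ = R := hconst.self_of_nhds
  simp [hv, h3, hR] at h2

/-- A `C¹` map that is the identity on a sphere centred at the origin has a zero in the
corresponding closed ball. -/
lemma exists_eq_zero_of_eq_id_on_sphere {h : E → E} (hh : ContDiff ℝ 1 h) {R : ℝ} (hR : 0 < R)
    (hid : ∀ x, ‖x‖ = R → h x = x) : ∃ x, ‖x‖ ≤ R ∧ h x = 0 := by
  classical
  by_contra! hne
  let r : E → E := fun x => (R / ‖h x‖) • h x
  let g : E → E := fun x => if x ∈ ball (0 : E) R then r x - x else 0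
  have hr : ∀ x ∈ closedBall (0 : E) R, ContDiffAt ℝ 1 r x := by
    intro x hx
    have hx0 : h x ≠ 0 := hne x (by simpa using hx)
    exact (contDiffAt_const.div (hh.contDiffAt.norm ℝ hx0) (norm_ne_zero_iff.2 hx0)).smul
      hh.contDiffAt
  have hgr : EqOn g (fun x => r x - x) (closedBall 0 R) := by
    intro x hx
    by_cases hxb : x ∈ ball (0 : E) R
    · simp only [g, if_pos hxb]
    · have hxR : ‖x‖ = R := le_antisymm (by simpa using hx) (by simpa using hxb)
      simp only [g, if_neg hxb, r, hid x hxR, hxR, div_self hR.ne', one_smul, sub_self]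
  have hzero : ∀ x ∉ ball (0 : E) R, g x = 0 := fun x hx => if_neg hx
  obtain ⟨L, hL⟩ : ∃ L, LipschitzOnWith L g (closedBall (0 : E) R) := by
    refine ContDiffOn.exists_lipschitzOnWith (n := 1) ?_ one_ne_zero (convex_closedBall _ _)
      (isCompact_closedBall _ _)
    exact ContDiffOn.congr (fun x hx => ((hr x hx).sub contDiffAt_id).contDiffWithinAt) hgr
  have hr' : ∀ x ∈ ball (0 : E) R, HasFDerivAt r (fderiv ℝ r x) x := fun x hx =>
    ((hr x (ball_subset_closedBall hx)).differentiableAt one_ne_zero).hasFDerivAt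
  borelize E
  have hpos : 0 < (Measure.addHaar : Measure E).real (ball 0 R) :=
    ENNReal.toReal_pos (measure_ball_pos _ _ hR).ne' measure_ball_lt_top.ne
  have hint := integral_det_one_add_fderiv (μ := Measure.addHaar)
    (g' := fun x => fderiv ℝ r x - 1) isOpen_ball hpos.ne'
    (lipschitzWith_of_lipschitzOnWith_closedBall hL hzero) hzero fun x hx => by
      refine ((hr' x hx).sub (hasFDerivAt_id x)).congr_of_eventuallyEq ?_
      filter_upwards [isOpen_ball.mem_nhds hx] with y hy
      exact hgr (ball_subset_closedBall hy)
  refine hpos.ne ?_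
  rw [← hint, setIntegral_eq_zero_of_forall_eq_zero]
  intro x hx
  rw [add_sub_cancel]
  refine det_eq_zero_of_norm_eventually_const (hr' x hx) hR.ne' ?_
  filter_upwards [isOpen_ball.mem_nhds hx] with y hy
  have hy0 : h y ≠ 0 := hne y (by simpa using (ball_subset_closedBall hy))
  simp [r, norm_smul, abs_of_pos hR, hy0]

/-- **Brouwer's fixed point theorem**, for bounded continuous self-maps of a Euclidean space. -/
theorem exists_fixedPoint_of_continuous_of_bounded {F : E → E} (hF : Continuous F) {M : ℝ}
    (hM : ∀ x, ‖F x‖ ≤ M) : ∃ x, F x = x := by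
  have hM0 : 0 ≤ M := (norm_nonneg _).trans (hM 0)
  have hcont : Continuous fun x => ‖F x - x‖ := (hF.sub continuous_id).norm
  obtain ⟨x₀, -, hx₀⟩ := (isCompact_closedBall (0 : E) (M + 1)).exists_isMinOn
    ⟨0, by simp; linarith⟩ hcont.continuousOn
  by_contra! hne
  have hε : 0 < ‖F x₀ - x₀‖ := norm_pos_iff.2 (sub_ne_zero.2 (hne x₀))
  have hδ : 0 < min ‖F x₀ - x₀‖ 1 := lt_min hε one_pos
  obtain ⟨G, hG, hGF⟩ : ∃ G : E → E, ContDiff ℝ 1 G ∧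
      ∀ x ∈ closedBall (0 : E) (M + 2), ‖F x - G x‖ < min ‖F x₀ - x₀‖ 1 := by
    have := ContinuousMap.dense_setOfPred_contDiff (⟨F, hF⟩ : C(E, E))
    rw [mem_closure_iff_nhds_basis (nhds_basis_uniformity
      Metric.uniformity_basis_dist.compactConvergenceUniformity)] at this
    obtain ⟨G, hG, hGF⟩ := this (closedBall 0 (M + 2), min ‖F x₀ - x₀‖ 1)
      ⟨isCompact_closedBall _ _, hδ⟩
    refine ⟨G, ContDiff.of_le (mem_ofPred_eq ▸ hG) (by exact_mod_cast le_top), fun x hx => ?_⟩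
    rw [← dist_eq_norm, dist_comm]
    exact hGF x hx
  let χ : ContDiffBump (0 : E) := ⟨M + 1, M + 2, by linarith, by linarith⟩
  obtain ⟨x, hxR, hx⟩ := exists_eq_zero_of_eq_id_on_sphere (h := fun x => x - χ x • G x)
    (contDiff_id.sub (χ.contDiff.smul hG)) (by linarith : 0 < M + 2) fun x hx => by
      have : χ x = 0 := χ.zero_of_le_dist (by simpa using hx.ge)
      simp [this]
  have hGx := hGF x (by simpa using hxR)
  have hGM : ‖G x‖ ≤ M + 1 := by
    have h1 := norm_sub_norm_le (G x) (F x)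
    rw [norm_sub_rev] at h1
    linarith [hM x, min_le_right ‖F x₀ - x₀‖ 1]
  have hxeq : x = χ x • G x := sub_eq_zero.1 hx
  have hxM : ‖x‖ ≤ M + 1 := by
    rw [hxeq, norm_smul, Real.norm_of_nonneg χ.nonneg]
    exact (mul_le_of_le_one_left (norm_nonneg _) χ.le_one).trans hGM
  have hχ : χ x = 1 := χ.one_of_mem_closedBall (by simpa using hxM)
  rw [hχ, one_smul] at hxeq
  rw [← hxeq] at hGx
  exact (hGx.trans_le (min_le_left _ _)).not_ge (hx₀ (by simpa using hxM))

end

/-- **Brouwer's fixed point theorem** for boxes. -/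
theorem exists_fixedPoint_of_mapsTo_Icc {ι : Type*} [Fintype ι] {a b : ι → ℝ} (hab : a ≤ b)
    {f : (ι → ℝ) → ι → ℝ} (hf : ContinuousOn f (Icc a b)) (hmaps : MapsTo f (Icc a b) (Icc a b)) :
    ∃ x ∈ Icc a b, f x = x := by
  have hc : ∀ x, a ⊔ (b ⊓ x) ∈ Icc a b := fun x => ⟨le_sup_left, sup_le hab inf_le_left⟩
  have hcont : Continuous fun x => f (a ⊔ (b ⊓ x)) :=
    hf.comp_continuous (continuous_pi fun i =>
      continuous_const.max (continuous_const.min (continuous_apply i))) hc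
  let e := EuclideanSpace.equiv ι ℝ
  have hcomp : IsCompact (e.symm '' Icc a b) := isCompact_Icc.image e.symm.continuous
  obtain ⟨M, hM⟩ := hcomp.isBounded.exists_norm_le
  obtain ⟨y, hy⟩ := exists_fixedPoint_of_continuous_of_bounded
    (F := fun y => e.symm (f (a ⊔ (b ⊓ e y)))) (e.symm.continuous.comp (hcont.comp e.continuous))
    (fun y => hM _ (mem_image_of_mem _ (hmaps (hc _))))
  have hy' : f (a ⊔ (b ⊓ e y)) = e y := e.symm_apply_eq.1 hy
  have hmem : e y ∈ Icc a b := hy' ▸ hmaps (hc _)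
  refine ⟨e y, hmem, ?_⟩
  rwa [inf_eq_right.2 hmem.2, sup_eq_right.2 hmem.1] at hy'

/-- The points of a perturbed equilateral set in `ℓ∞ᵏ`, with perturbations `ε`. -/
def perturbedPoint {k : ℕ} (ε : Fin k × Fin (k + 1) → ℝ) (j : Fin (k + 1)) : Fin k → ℝ :=
  fun l => if (l : ℕ) < j then ε (l, j) else if (l : ℕ) = j then -1 else 0

lemma continuous_perturbedPoint {k : ℕ} (j : Fin (k + 1)) :
    Continuous fun ε : Fin k × Fin (k + 1) → ℝ => perturbedPoint ε j := by
  refine continuous_pi fun l => ?_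
  unfold perturbedPoint
  split_ifs <;> fun_prop

lemma norm_perturbedPoint_sub {k : ℕ} {ε : Fin k × Fin (k + 1) → ℝ} (h0 : ∀ q, 0 ≤ ε q)
    (h1 : ∀ q, ε q ≤ 1 / 2) {i : Fin k} {j : Fin (k + 1)} (hij : (i : ℕ) < j) :
    ‖perturbedPoint ε i.castSucc - perturbedPoint ε j‖ = 1 + ε (i, j) := by
  have hε := h0 (i, j)
  apply le_antisymm
  · refine (pi_norm_le_iff_of_nonneg (by linarith)).2 fun l => ?_
    have ha := h0 (l, i.castSucc)
    have ha' := h1 (l, i.castSucc)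
    have hb := h0 (l, j)
    have hb' := h1 (l, j)
    rw [Real.norm_eq_abs, abs_le, Pi.sub_apply]
    rcases eq_or_ne l i with rfl | hl
    · simp only [perturbedPoint, Fin.val_castSucc, lt_irrefl, if_false, if_true, if_pos hij]
      constructor <;> linarith
    · have hl' : (l : ℕ) ≠ i := fun h => hl (Fin.ext h)
      simp only [perturbedPoint, Fin.val_castSucc, if_neg hl']
      split_ifs <;> first | omega | (constructor <;> linarith)
  · refine le_trans ?_ (norm_le_pi_norm _ i)
    simp only [perturbedPoint, Pi.sub_apply, Fin.val_castSucc, lt_irrefl, if_false, if_true,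
      if_pos hij]
    rw [Real.norm_eq_abs, abs_of_nonpos (by linarith)]
    linarith

lemma exists_equilateral_of_linearMap {X : Type*} [NormedAddCommGroup X] [NormedSpace ℝ X]
    {k : ℕ} (U : (Fin k → ℝ) →L[ℝ] X) (hle : ∀ x, ‖U x‖ ≤ ‖x‖)
    (hge : ∀ x, ‖x‖ ≤ 3 / 2 * ‖U x‖) :
    ∃ S : Finset X, S.card = k + 1 ∧ IsEquilateral (S : Set X) := by
  classical
  let f : (Fin k × Fin (k + 1) → ℝ) → Fin k × Fin (k + 1) → ℝ := fun ε q =>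
    if (q.1 : ℕ) < q.2 then
      1 + ε q - ‖U (perturbedPoint ε q.1.castSucc - perturbedPoint ε q.2)‖ else 0
  have hf : Continuous f := by
    refine continuous_pi fun q => ?_
    have h1 := continuous_perturbedPoint (k := k) q.1.castSucc
    have h2 := continuous_perturbedPoint (k := k) q.2
    simp only [f]
    split_ifs <;> fun_prop
  obtain ⟨ε, ⟨h0, h1⟩, hε⟩ := exists_fixedPoint_of_mapsTo_Icc (a := fun _ => 0)
    (b := fun _ => 1 / 2) (fun _ => by norm_num) hf.continuousOn (by
      rintro ε ⟨h0, h1⟩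
      rw [mem_Icc, Pi.le_def, Pi.le_def, ← forall_and]
      intro q
      simp only [f]
      split_ifs with hq
      · have hn := norm_perturbedPoint_sub h0 h1 hq
        have hle' := hle (perturbedPoint ε q.1.castSucc - perturbedPoint ε q.2)
        have hge' := hge (perturbedPoint ε q.1.castSucc - perturbedPoint ε q.2)
        rw [hn] at hle' hge'
        have hq1 : ε q ≤ 1 / 2 := h1 q
        constructor <;> linarith
      · norm_num)
  have hlt : ∀ i j : Fin (k + 1), i < j →
      ‖U (perturbedPoint ε i) - U (perturbedPoint ε j)‖ = 1 := by
    intro i j hij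
    have hi : (i : ℕ) < k := by have := Fin.lt_def.1 hij; omega
    have h := congrFun hε (⟨i, hi⟩, j)
    simp only [f, if_pos (Fin.lt_def.1 hij), Fin.castSucc_mk, Fin.eta] at h
    rw [← map_sub]
    linarith
  have hdist : ∀ i j : Fin (k + 1), i ≠ j →
      ‖U (perturbedPoint ε i) - U (perturbedPoint ε j)‖ = 1 := by
    intro i j hij
    rcases lt_or_gt_of_ne hij with h | h
    · exact hlt i j h
    · rw [norm_sub_rev]
      exact hlt j i h
  have hinj : Function.Injective fun j => U (perturbedPoint ε j) := by
    intro i j hij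
    by_contra hne
    have := hdist i j hne
    rw [sub_eq_zero.2 hij, norm_zero] at this
    exact zero_ne_one this
  refine ⟨Finset.univ.image fun j => U (perturbedPoint ε j), ?_, 1, one_pos, ?_⟩
  · rw [Finset.card_image_of_injective _ hinj, Finset.card_univ, Fintype.card_fin]
  · simp only [Finset.coe_image, Finset.coe_univ, image_univ]
    rintro _ ⟨i, rfl⟩ _ ⟨j, rfl⟩ hij
    exact hdist i j fun h => hij (by rw [h])

/-- Normalizing an isomorphism: a Banach–Mazur distance less than `c` is witnessed by a
contraction from `Z` to `Y` whose inverse has norm at most `c`. -/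
lemma exists_contraction_of_bmdist_lt {Y Z : Type*} [NormedAddCommGroup Y] [NormedSpace ℝ Y]
    [NormedAddCommGroup Z] [NormedSpace ℝ Z] (hYZ : Nonempty (Y ≃L[ℝ] Z)) {c : ℝ}
    (h : BMdist Y Z < c) :
    ∃ U : Z →L[ℝ] Y, ‖U‖ ≤ 1 ∧ ∀ z, ‖z‖ ≤ c * ‖U z‖ := by
  obtain ⟨T₀⟩ := hYZ
  rw [BMdist] at h
  obtain ⟨_, ⟨T, rfl⟩, hT⟩ := exists_lt_of_csInf_lt (by exact ⟨_, T₀, rfl⟩) h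
  set d := ‖(T.symm : Z →L[ℝ] Y)‖ with hd
  have hd0 : 0 ≤ d := norm_nonneg _
  refine ⟨d⁻¹ • (T.symm : Z →L[ℝ] Y), ?_, fun z => ?_⟩
  · rw [norm_smul, norm_inv, Real.norm_of_nonneg hd0, ← hd]
    exact inv_mul_le_one
  · have h1 : ‖z‖ ≤ ‖(T : Y →L[ℝ] Z)‖ * ‖T.symm z‖ := by
      simpa using (T : Y →L[ℝ] Z).le_opNorm (T.symm z)
    have h2 : ‖T.symm z‖ ≤ d * ‖z‖ := (T.symm : Z →L[ℝ] Y).le_opNorm z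
    rcases hd0.eq_or_lt with h0 | h0
    · rw [← h0, zero_mul] at h2
      have hz : ‖z‖ ≤ 0 := h1.trans (mul_nonpos_of_nonneg_of_nonpos (norm_nonneg _) h2)
      simp [norm_le_zero_iff.1 hz]
    · calc ‖z‖ ≤ ‖(T : Y →L[ℝ] Z)‖ * ‖T.symm z‖ := h1
        _ = ‖(T : Y →L[ℝ] Z)‖ * d * (d⁻¹ * ‖T.symm z‖) := by field_simp
        _ ≤ c * (d⁻¹ * ‖T.symm z‖) := by gcongr
        _ = _ := by simp [norm_smul, abs_of_pos h0]

/-- In finite dimensions the Banach–Mazur distance is attained. -/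
lemma exists_contraction_of_bmdist_le {Y Z : Type*} [NormedAddCommGroup Y] [NormedSpace ℝ Y]
    [FiniteDimensional ℝ Y] [NormedAddCommGroup Z] [NormedSpace ℝ Z] [FiniteDimensional ℝ Z]
    (hYZ : Nonempty (Y ≃L[ℝ] Z)) {c : ℝ} (h : BMdist Y Z ≤ c) :
    ∃ U : Z →L[ℝ] Y, ‖U‖ ≤ 1 ∧ ∀ z, ‖z‖ ≤ c * ‖U z‖ := by
  have hn : ∀ n : ℕ, ∃ U : Z →L[ℝ] Y, ‖U‖ ≤ 1 ∧ ∀ z, ‖z‖ ≤ (c + 1 / ((n : ℝ) + 1)) * ‖U z‖ :=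
    fun n => exists_contraction_of_bmdist_lt hYZ
      (h.trans_lt (lt_add_of_pos_right _ Nat.one_div_pos_of_nat))
  choose U hU hUz using hn
  obtain ⟨V, hV, φ, hφ, hlim⟩ := (isCompact_closedBall (0 : Z →L[ℝ] Y) 1).tendsto_subseq
    (x := U) fun n => by simpa using hU n
  refine ⟨V, by simpa using hV, fun z => ?_⟩
  have hz : Filter.Tendsto (fun n => U (φ n) z) Filter.atTop (nhds (V z)) :=
    ((ContinuousLinearMap.apply ℝ Y z).continuous.tendsto V).comp hlim
  have hc : Filter.Tendsto (fun n => c + 1 / ((φ n : ℝ) + 1)) Filter.atTop (nhds (c + 0)) :=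
    tendsto_const_nhds.add (tendsto_one_div_add_atTop_nhds_zero_nat.comp hφ.tendsto_atTop)
  rw [add_zero] at hc
  exact ge_of_tendsto' (hc.mul hz.norm) fun n => hUz (φ n) z

/-- If a finite-dimensional real normed space `X` has a `k`-dimensional linear subspace
`Y` (with the induced norm) whose Banach–Mazur distance from `ℓ∞ᵏ` (that is,
`Fin k → ℝ` with the sup norm) is at most `3/2`, then `X` contains an equilateral set
of `k + 1` points, i.e. `e(X) ≥ k + 1`. -/
theorem equilateral_of_subspace_bmdist_linf_le (X : Type*) [NormedAddCommGroup X]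
    [NormedSpace ℝ X] [FiniteDimensional ℝ X] (k : ℕ) (Y : Submodule ℝ X)
    (hdim : Module.finrank ℝ Y = k) (hBM : BMdist Y (Fin k → ℝ) ≤ 3 / 2) :
    ∃ S : Finset X, S.card = k + 1 ∧ IsEquilateral (S : Set X) := by
  have e : Nonempty (Y ≃L[ℝ] (Fin k → ℝ)) :=
    ⟨ContinuousLinearEquiv.ofFinrankEq (by simp [hdim])⟩
  obtain ⟨U, hU, hUge⟩ := exists_contraction_of_bmdist_le e hBM
  refine exists_equilateral_of_linearMap (Y.subtypeL ∘L U) (fun x => ?_) hUge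
  exact (U.le_opNorm x).trans (mul_le_of_le_one_left (norm_nonneg _) hU)
end
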